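/- arXiv:1108.3118 — 3 statements merged into one kernel-verified Lean document; each statement's English description precedes it below -/
import Mathlib

section
/- Let N ≥ 1 and let ω₁, ω₂ : ℝ^N → ℝ be smooth positive functions. Suppose there exists t with 0 < t < 2 such that I_G(R) → 0 and J_G(R) → 0 as R → ∞, where I_G(R) = R^{-4t-2} ∫_{R<|x|<2R} ω₁^{2t+1}/ω₂^{2t} dx and J_G(R) = R^{-2t-1} ∫_{R<|x|<2R} |∇ω₁|^{2t+1}/ω₂^{2t} dx. Then there is no stable sub-solution of the equation −div(ω₁ ∇u) = ω₂ e^u in ℝ^N. -/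
open MeasureTheory Filter Real
open scoped RealInnerProductSpace

noncomputable def vdiv {N : ℕ} (V : EuclideanSpace ℝ (Fin N) → EuclideanSpace ℝ (Fin N))
    (x : EuclideanSpace ℝ (Fin N)) : ℝ :=
  LinearMap.trace ℝ (EuclideanSpace ℝ (Fin N)) (fderiv ℝ V x).toLinearMap

def annulus (N : ℕ) (R : ℝ) : Set (EuclideanSpace ℝ (Fin N)) :=
  {x | R < ‖x‖ ∧ ‖x‖ < 2 * R}

theorem ContDiff.continuous_gradient {E : Type*} [NormedAddCommGroup E] [InnerProductSpace ℝ E]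
    [CompleteSpace E] {f : E → ℝ} (hf : ContDiff ℝ 1 f) : Continuous (gradient f) :=
  (InnerProductSpace.toDual ℝ E).symm.continuous.comp (hf.continuous_fderiv one_ne_zero)

theorem norm_gradient_eq_norm_fderiv {E : Type*} [NormedAddCommGroup E] [InnerProductSpace ℝ E]
    [CompleteSpace E] (f : E → ℝ) (x : E) : ‖gradient f x‖ = ‖fderiv ℝ f x‖ :=
  (InnerProductSpace.toDual ℝ E).symm.norm_map _

/-- Integration by parts against a divergence, for a compactly supported test function. -/
theorem integral_mul_vdiv {N : ℕ} {f : EuclideanSpace ℝ (Fin N) → ℝ}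
    {V : EuclideanSpace ℝ (Fin N) → EuclideanSpace ℝ (Fin N)}
    (hf : ContDiff ℝ 1 f) (hfc : HasCompactSupport f) (hV : ContDiff ℝ 1 V) :
    ∫ x, f x * vdiv V x = -∫ x, fderiv ℝ f x (V x) := by
  set b := EuclideanSpace.basisFun (Fin N) ℝ
  have hf' : Continuous (fderiv ℝ f) := hf.continuous_fderiv one_ne_zero
  have hV' : Continuous (fderiv ℝ V) := hV.continuous_fderiv one_ne_zero
  have hcoord : ∀ i, ContDiff ℝ 1 fun x => inner ℝ (b i) (V x) := fun i => contDiff_const.inner ℝ hV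
  have hcoord' : ∀ i x, fderiv ℝ (fun x => inner ℝ (b i) (V x)) x (b i)
      = inner ℝ (b i) (fderiv ℝ V x (b i)) := by
    intro i x
    rw [fderiv_inner_apply ℝ (by fun_prop) ((hV.differentiable one_ne_zero) x)]
    simp
  have hint1 : ∀ i, Integrable fun x => fderiv ℝ f x (b i) * inner ℝ (b i) (V x) := by
    intro i
    refine Continuous.integrable_of_hasCompactSupport
      ((hf'.clm_apply continuous_const).mul (hcoord i).continuous) ?_
    exact (hfc.fderiv_apply ℝ (b i)).mul_right
  have hint2 : ∀ i, Integrable fun x => f x * inner ℝ (b i) (fderiv ℝ V x (b i)) := by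
    intro i
    refine Continuous.integrable_of_hasCompactSupport
      (hf.continuous.mul (continuous_const.inner (hV'.clm_apply continuous_const))) hfc.mul_right
  have hparts : ∀ i, ∫ x, f x * inner ℝ (b i) (fderiv ℝ V x (b i))
      = -∫ x, fderiv ℝ f x (b i) * inner ℝ (b i) (V x) := by
    intro i
    have := integral_mul_fderiv_eq_neg_fderiv_mul_of_integrable (μ := volume) (v := b i)
      (f := f) (g := fun x => inner ℝ (b i) (V x)) (hint1 i)
      (by simpa only [hcoord'] using hint2 i)
      (Continuous.integrable_of_hasCompactSupport
        (hf.continuous.mul (hcoord i).continuous) hfc.mul_right)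
      (fun x _ => hf.differentiable one_ne_zero x)
      (fun x _ => (hcoord i).differentiable one_ne_zero x)
    simpa only [hcoord'] using this
  have hl : ∀ x, f x * vdiv V x = ∑ i, f x * inner ℝ (b i) (fderiv ℝ V x (b i)) := by
    intro x
    rw [vdiv, LinearMap.trace_eq_sum_inner _ b, Finset.mul_sum]
    rfl
  have hr : ∀ x, fderiv ℝ f x (V x) = ∑ i, fderiv ℝ f x (b i) * inner ℝ (b i) (V x) := by
    intro x
    conv_lhs => rw [← b.sum_repr' (V x), map_sum]
    exact Finset.sum_congr rfl fun i _ => by rw [map_smul, smul_eq_mul, mul_comm]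
  simp only [hl, hr]
  rw [integral_finsetSum _ fun i _ => hint2 i, integral_finsetSum _ fun i _ => hint1 i,
    ← Finset.sum_neg_distrib]
  exact Finset.sum_congr rfl fun i _ => hparts i

/-- Caccioppoli-type inequality for stable sub-solutions, tested with `exp (t * u) * φ`. -/
theorem exists_stable_energy_bound {t : ℝ} (ht0 : 0 < t) (ht2 : t < 2) :
    ∃ C : ℝ, 0 < C ∧ ∀ (N : ℕ) (ω₁ ω₂ u φ : EuclideanSpace ℝ (Fin N) → ℝ),
      ContDiff ℝ 1 ω₁ → Continuous ω₂ → (∀ x, 0 < ω₁ x) → (∀ x, 0 < ω₂ x) → ContDiff ℝ 2 u →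
      (∀ x, -vdiv (fun y => ω₁ y • gradient u y) x ≤ ω₂ x * Real.exp (u x)) →
      (∀ ψ : EuclideanSpace ℝ (Fin N) → ℝ, ContDiff ℝ 2 ψ → HasCompactSupport ψ →
        ∫ x, ω₂ x * Real.exp (u x) * ψ x ^ 2 ≤ ∫ x, ω₁ x * ‖gradient ψ x‖ ^ 2) →
      ContDiff ℝ 2 φ → HasCompactSupport φ →
      ∫ x, ω₂ x * Real.exp ((2 * t + 1) * u x) * φ x ^ 2
        ≤ C * ∫ x, ω₁ x * Real.exp (2 * t * u x) * ‖gradient φ x‖ ^ 2 := by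
  obtain ⟨δ, hδ0, hδt, hδκ⟩ : ∃ δ : ℝ, 0 < δ ∧ δ ≤ t / 2 ∧ δ ≤ (1 - t / 2) / 2 :=
    ⟨min (t / 2) ((1 - t / 2) / 2), lt_min (by linarith) (by linarith), min_le_left _ _,
      min_le_right _ _⟩
  have hκ : 0 < (1 - t / 2) / 2 := by linarith
  refine ⟨(3 / 2 + t / (4 * δ)) / ((1 - t / 2) / 2), by positivity, ?_⟩
  intro N ω₁ ω₂ u φ hω₁ hω₂ hω₁pos hω₂pos hu hsub hstab hφ hφc
  have hu1 : ContDiff ℝ 1 u := hu.of_le (by norm_num)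
  have hφ1 : ContDiff ℝ 1 φ := hφ.of_le (by norm_num)
  have hGu : ContDiff ℝ 1 (gradient u) :=
    (InnerProductSpace.toDual ℝ (EuclideanSpace ℝ (Fin N))).symm.contDiff.comp
      (hu.fderiv_right (by norm_num))
  have hcu := hu.continuous
  have hcφ := hφ.continuous
  have hcω₁ := hω₁.continuous
  have hcGu := hGu.continuous
  have hcGφ := hφ1.continuous_gradient
  have hGφc : HasCompactSupport (gradient φ) :=
    (hφc.fderiv ℝ).comp_left (map_zero (InnerProductSpace.toDual ℝ (EuclideanSpace ℝ (Fin N))).symm)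
  have du : ∀ x, HasFDerivAt u (fderiv ℝ u x) x := fun x =>
    (hu1.differentiable one_ne_zero x).hasFDerivAt
  have dφ : ∀ x, HasFDerivAt φ (fderiv ℝ φ x) x := fun x =>
    (hφ1.differentiable one_ne_zero x).hasFDerivAt
  set a : EuclideanSpace ℝ (Fin N) → ℝ :=
    fun x => ω₁ x * Real.exp (2 * t * u x) * φ x ^ 2 * ‖gradient u x‖ ^ 2
  set b : EuclideanSpace ℝ (Fin N) → ℝ :=
    fun x => ω₂ x * Real.exp ((2 * t + 1) * u x) * φ x ^ 2
  set c : EuclideanSpace ℝ (Fin N) → ℝ :=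
    fun x => ω₁ x * Real.exp (2 * t * u x) * (φ x * inner ℝ (gradient φ x) (gradient u x))
  set d : EuclideanSpace ℝ (Fin N) → ℝ :=
    fun x => ω₁ x * Real.exp (2 * t * u x) * ‖gradient φ x‖ ^ 2
  have hφ2c : HasCompactSupport fun x => φ x ^ 2 := hφc.comp_left (g := fun y => y ^ 2) (by simp)
  have ha : Integrable a := Continuous.integrable_of_hasCompactSupport (by fun_prop)
    (hφ2c.mul_left.mul_right)
  have hb : Integrable b := Continuous.integrable_of_hasCompactSupport (by fun_prop)
    hφ2c.mul_left
  have hc : Integrable c := Continuous.integrable_of_hasCompactSupport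
    (by have := hcGφ.inner (𝕜 := ℝ) hcGu; fun_prop) (hφc.mul_right.mul_left)
  have hd : Integrable d := Continuous.integrable_of_hasCompactSupport (by fun_prop)
    (hGφc.comp_left (g := fun y => ‖y‖ ^ 2) (by simp)).mul_left
  have stable : ∫ x, b x ≤ t ^ 2 * (∫ x, a x) + 2 * t * (∫ x, c x) + ∫ x, d x := by
    have h := hstab (fun x => Real.exp (t * u x) * φ x) (by fun_prop) hφc.mul_left
    have hg : ∀ x, gradient (fun x => Real.exp (t * u x) * φ x) x
        = Real.exp (t * u x) • (gradient φ x + (t * φ x) • gradient u x) := by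
      intro x
      refine HasGradientAt.gradient ?_
      rw [hasGradientAt_iff_hasFDerivAt]
      refine (((du x).const_mul t).exp.mul (dφ x)).congr_fderiv ?_
      ext v
      simp
      ring
    have e1 : ∀ x, ω₂ x * Real.exp (u x) * (Real.exp (t * u x) * φ x) ^ 2 = b x := by
      intro x
      simp only [b]
      rw [show (2 * t + 1) * u x = u x + t * u x + t * u x by ring, Real.exp_add, Real.exp_add]
      ring
    have e2 : ∀ x, ω₁ x * ‖gradient (fun x => Real.exp (t * u x) * φ x) x‖ ^ 2
        = t ^ 2 * a x + 2 * t * c x + d x := by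
      intro x
      simp only [a, c, d]
      rw [hg, norm_smul, mul_pow, norm_add_sq_real, norm_smul, inner_smul_right,
        show 2 * t * u x = t * u x + t * u x by ring, Real.exp_add, mul_pow]
      simp only [Real.norm_eq_abs, sq_abs]
      ring
    simp only [e1, e2] at h
    have hac : Integrable fun x => t ^ 2 * a x + 2 * t * c x :=
      (ha.const_mul _).add (hc.const_mul _)
    rwa [integral_add hac hd,
      integral_add (ha.const_mul _) (hc.const_mul _), integral_const_mul, integral_const_mul] at h
  have subsol : 2 * t * (∫ x, a x) + 2 * (∫ x, c x) ≤ ∫ x, b x := by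
    set g : EuclideanSpace ℝ (Fin N) → ℝ := fun x => Real.exp (2 * t * u x) * φ x ^ 2
    have hg1 : ContDiff ℝ 1 g := by fun_prop
    have hgc : HasCompactSupport g := hφ2c.mul_left
    have hV : ContDiff ℝ 1 fun y => ω₁ y • gradient u y := hω₁.smul hGu
    have h := integral_mul_vdiv hg1 hgc hV
    have e : ∀ x, fderiv ℝ g x (ω₁ x • gradient u x) = 2 * t * a x + 2 * c x := by
      intro x
      have := (((du x).const_mul (2 * t)).exp.mul ((dφ x).pow 2)).fderiv
      simp only [a, c]
      rw [show g = fun x => Real.exp (2 * t * u x) * φ x ^ 2 from rfl]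
      erw [this]
      rw [← real_inner_self_eq_norm_sq, inner_gradient_left, inner_gradient_left]
      simp
      ring
    have hle : ∫ x, -(g x * vdiv (fun y => ω₁ y • gradient u y) x) ≤ ∫ x, b x := by
      refine integral_mono ?_ hb fun x => ?_
      · refine (Continuous.integrable_of_hasCompactSupport ?_ hgc.mul_right).neg
        refine hg1.continuous.mul ?_
        have hV' := hV.continuous_fderiv one_ne_zero
        have : vdiv (fun y => ω₁ y • gradient u y) = fun x =>
            ∑ i, inner ℝ (EuclideanSpace.basisFun (Fin N) ℝ i)
              (fderiv ℝ (fun y => ω₁ y • gradient u y) x (EuclideanSpace.basisFun (Fin N) ℝ i)) :=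
          funext fun x => LinearMap.trace_eq_sum_inner _ _
        rw [this]
        exact continuous_finsetSum _ fun i _ =>
          continuous_const.inner (hV'.clm_apply continuous_const)
      · have hg0 : 0 ≤ g x := by positivity
        have := mul_le_mul_of_nonneg_left (hsub x) hg0
        have e1 : g x * (ω₂ x * Real.exp (u x)) = b x := by
          simp only [g, b]
          rw [show (2 * t + 1) * u x = 2 * t * u x + u x by ring, Real.exp_add]
          ring
        simp only
        linarith
    rw [integral_neg, h, neg_neg] at hle
    simp only [e] at hle
    rwa [integral_add (ha.const_mul _) (hc.const_mul _), integral_const_mul,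
      integral_const_mul] at hle
  have cross : ∀ x, |c x| ≤ δ * a x + 1 / (4 * δ) * d x := by
    intro x
    have hw : 0 ≤ ω₁ x * Real.exp (2 * t * u x) := by have := hω₁pos x; positivity
    have hcs := abs_real_inner_le_norm (gradient φ x) (gradient u x)
    simp only [a, c, d]
    rw [abs_mul, abs_of_nonneg hw, abs_mul]
    have h1 : |φ x| * |inner ℝ (gradient φ x) (gradient u x)|
        ≤ δ * (φ x ^ 2 * ‖gradient u x‖ ^ 2) + 1 / (4 * δ) * ‖gradient φ x‖ ^ 2 := by
      have h2 := mul_le_mul_of_nonneg_left hcs (abs_nonneg (φ x))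
      have h3 : 0 ≤ δ * (|φ x| * ‖gradient u x‖ - 1 / (2 * δ) * ‖gradient φ x‖) ^ 2 := by
        positivity
      have h4 : δ * (|φ x| * ‖gradient u x‖ - 1 / (2 * δ) * ‖gradient φ x‖) ^ 2
          = δ * (|φ x| ^ 2 * ‖gradient u x‖ ^ 2) + 1 / (4 * δ) * ‖gradient φ x‖ ^ 2
            - |φ x| * (‖gradient φ x‖ * ‖gradient u x‖) := by
        field_simp
        ring
      rw [sq_abs] at h4
      linarith
    calc _ ≤ _ := mul_le_mul_of_nonneg_left h1 hw
      _ = _ := by ring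
  have hcr : |∫ x, c x| ≤ δ * (∫ x, a x) + 1 / (4 * δ) * ∫ x, d x := by
    refine (abs_integral_le_integral_abs).trans ?_
    rw [← integral_const_mul, ← integral_const_mul,
      ← integral_add (ha.const_mul _) (hd.const_mul _)]
    exact integral_mono hc.abs ((ha.const_mul _).add (hd.const_mul _)) cross
  have hA0 : 0 ≤ ∫ x, a x := integral_nonneg fun x => by
    have := hω₁pos x
    simp only [a, Pi.zero_apply]
    positivity
  have hB0 : 0 ≤ ∫ x, b x := integral_nonneg fun x => by
    have := hω₂pos x
    simp only [b, Pi.zero_apply]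
    positivity
  generalize (∫ x, a x) = A at *
  generalize (∫ x, b x) = B at *
  generalize (∫ x, c x) = X at *
  generalize (∫ x, d x) = D at *
  rw [div_mul_eq_mul_div, le_div_iff₀ hκ]
  obtain ⟨hX1, hX2⟩ := abs_le.1 hcr
  have htA : t * A ≤ B + 2 * (1 / (4 * δ) * D) := by
    nlinarith [mul_le_mul_of_nonneg_right hδt hA0]
  have hBδ : (1 - t / 2) * B ≤ D + t * X := by nlinarith
  have h5 : t * X ≤ δ * (B + 2 * (1 / (4 * δ) * D)) + t * (1 / (4 * δ) * D) := by
    nlinarith [mul_le_mul_of_nonneg_left hX2 ht0.le, mul_le_mul_of_nonneg_left htA hδ0.le]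
  have h6 : δ * (B + 2 * (1 / (4 * δ) * D)) + t * (1 / (4 * δ) * D)
      = δ * B + D / 2 + t / (4 * δ) * D := by
    field_simp
    ring
  nlinarith [mul_le_mul_of_nonneg_right hδκ hB0]

theorem exists_rpow_mul_le_add {s ε : ℝ} (hs : 0 < s) (hε : 0 < ε) :
    ∃ K : ℝ, 0 < K ∧ ∀ x y : ℝ, 0 ≤ x → 0 ≤ y →
      x ^ s * y ≤ ε * x ^ (s + 1) + K * y ^ (s + 1) := by
  refine ⟨(ε ^ s)⁻¹, by positivity, fun x y hx hy => ?_⟩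
  rw [Real.rpow_add_one' hx (by linarith), Real.rpow_add_one' hy (by linarith)]
  have hxs : 0 ≤ x ^ s := Real.rpow_nonneg hx s
  have hys : 0 ≤ y ^ s := Real.rpow_nonneg hy s
  rcases le_total y (ε * x) with h | h
  · have h1 : x ^ s * y ≤ x ^ s * (ε * x) := by gcongr
    have h2 : 0 ≤ (ε ^ s)⁻¹ * (y ^ s * y) := by positivity
    linarith
  · have h1 : ε ^ s * x ^ s ≤ y ^ s := by
      rw [← Real.mul_rpow hε.le hx]
      exact Real.rpow_le_rpow (by positivity) h hs.le
    have h2 : x ^ s ≤ (ε ^ s)⁻¹ * y ^ s := by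
      rw [inv_mul_eq_div, le_div_iff₀ (by positivity)]
      linarith
    have h3 : x ^ s * y ≤ (ε ^ s)⁻¹ * y ^ s * y := by gcongr
    have h4 : 0 ≤ ε * (x ^ s * x) := by positivity
    linarith

theorem exists_weighted_young {s ε : ℝ} (hs : 0 < s) (hs4 : s < 4) (hε : 0 < ε) :
    ∃ K : ℝ, 0 < K ∧ ∀ w₁ w₂ e h r : ℝ, 0 < w₁ → 0 < w₂ → 0 < e → 0 ≤ h → h ≤ 1 → 0 ≤ r →
      w₁ * e ^ s * (h ^ 8 * r)
        ≤ ε * (w₂ * e ^ (s + 1) * (h ^ 5) ^ 2) + K * r ^ (s + 1) * (w₁ ^ (s + 1) / w₂ ^ s) := by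
  obtain ⟨K, hK, hyoung⟩ := exists_rpow_mul_le_add hs hε
  refine ⟨K, hK, fun w₁ w₂ e h r hw₁ hw₂ he hh hh1 hr => ?_⟩
  have hx : 0 ≤ h ^ (8 / s) := Real.rpow_nonneg hh _
  have key := mul_le_mul_of_nonneg_left
    (hyoung (e * h ^ (8 / s)) (w₁ * r / w₂) (by positivity) (by positivity)) hw₂.le
  have e1 : (e * h ^ (8 / s)) ^ s = e ^ s * h ^ 8 := by
    rw [Real.mul_rpow he.le hx, ← Real.rpow_mul hh, div_mul_cancel₀ _ hs.ne']
    norm_cast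
  have e2 : (e * h ^ (8 / s)) ^ (s + 1) ≤ e ^ (s + 1) * (h ^ 5) ^ 2 := by
    rw [Real.mul_rpow he.le hx, ← Real.rpow_mul hh]
    have h8 : 2 ≤ 8 / s := by rw [le_div_iff₀ hs]; linarith
    have : h ^ (8 / s * (s + 1)) ≤ (h ^ 5) ^ 2 := by
      rw [← pow_mul, mul_add, div_mul_cancel₀ _ hs.ne', mul_one]
      have h10 : h ^ (5 * 2) = h ^ (10 : ℝ) := by norm_cast
      rw [h10]
      exact Real.rpow_le_rpow_of_exponent_ge_of_imp hh hh1 (by linarith) fun _ h0 => by linarith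
    gcongr
  have e3 : w₂ * (w₁ * r / w₂) ^ (s + 1) = r ^ (s + 1) * (w₁ ^ (s + 1) / w₂ ^ s) := by
    rw [Real.div_rpow (by positivity) hw₂.le, Real.mul_rpow hw₁.le hr, Real.rpow_add_one hw₂.ne']
    have : 0 < w₂ ^ s := Real.rpow_pos_of_pos hw₂ s
    field_simp
  rw [e1, mul_add] at key
  have e4 := mul_le_mul_of_nonneg_left e2 (mul_nonneg hw₂.le hε.le)
  have e5 : w₂ * (e ^ s * h ^ 8 * (w₁ * r / w₂)) = w₁ * e ^ s * (h ^ 8 * r) := by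
    field_simp
  rw [e5] at key
  calc _ ≤ _ := key
    _ = w₂ * ε * (e * h ^ (8 / s)) ^ (s + 1) + K * (w₂ * (w₁ * r / w₂) ^ (s + 1)) := by ring
    _ ≤ _ := by rw [e3]; linarith

/-- Smooth cutoffs between the balls of radii `R` and `2 * R`, with gradient `O(1 / R)`. -/
theorem exists_cutoff (N : ℕ) :
    ∃ M : ℝ, ∀ R : ℝ, 0 < R → ∃ η : EuclideanSpace ℝ (Fin N) → ℝ,
      ContDiff ℝ 2 η ∧ HasCompactSupport η ∧ (∀ x, 0 ≤ η x) ∧ (∀ x, η x ≤ 1) ∧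
      (∀ x, ‖x‖ ≤ R → η x = 1) ∧ (∀ x, 2 * R ≤ ‖x‖ → η x = 0) ∧
      (∀ x, ‖fderiv ℝ η x‖ ≤ M / R) ∧ ∀ x, x ∉ annulus N R → fderiv ℝ η x = 0 := by
  let f : ContDiffBump (0 : EuclideanSpace ℝ (Fin N)) := ⟨1, 2, one_pos, one_lt_two⟩
  have hf : ContDiff ℝ 2 f := f.contDiff (n := 2)
  obtain ⟨M, hM⟩ := (f.hasCompactSupport.fderiv ℝ).exists_bound_of_continuous
    (hf.continuous_fderiv two_ne_zero)
  refine ⟨M, fun R hR => ?_⟩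
  have hnorm : ∀ x : EuclideanSpace ℝ (Fin N), ‖R⁻¹ • x‖ = ‖x‖ / R := fun x => by
    rw [norm_smul, norm_inv, Real.norm_of_nonneg hR.le, inv_mul_eq_div]
  have h0 : ∀ x, 0 ≤ f (R⁻¹ • x) := fun x => f.nonneg
  have h1 : ∀ x, f (R⁻¹ • x) ≤ 1 := fun x => f.le_one
  have hone : ∀ x, ‖x‖ ≤ R → f (R⁻¹ • x) = 1 := fun x hx => by
    refine f.one_of_mem_closedBall ?_
    rw [mem_closedBall_zero_iff, hnorm]
    exact (div_le_one hR).2 hx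
  have hzero : ∀ x, 2 * R ≤ ‖x‖ → f (R⁻¹ • x) = 0 := fun x hx => by
    refine f.zero_of_le_dist ?_
    rw [dist_zero_right, hnorm]
    exact (le_div_iff₀ hR).2 hx
  refine ⟨fun x => f (R⁻¹ • x), hf.comp (contDiff_const_smul _),
    f.hasCompactSupport.comp_smul (inv_ne_zero hR.ne'), h0, h1, hone, hzero, fun x => ?_,
    fun x hx => ?_⟩
  · rw [fderiv_comp_smul, norm_smul, norm_inv, Real.norm_of_nonneg hR.le, inv_mul_eq_div]
    exact div_le_div_of_nonneg_right (hM _) hR.le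
  · by_cases hxR : ‖x‖ ≤ R
    · exact IsLocalMax.fderiv_eq_zero (Eventually.of_forall fun y => by
        simpa only [hone x hxR] using h1 y)
    · have hx2 : 2 * R ≤ ‖x‖ := by
        by_contra hlt
        exact hx ⟨not_le.1 hxR, not_le.1 hlt⟩
      exact IsLocalMin.fderiv_eq_zero (Eventually.of_forall fun y => by
        simpa only [hzero x hx2] using h0 y)

theorem integrableOn_annulus {N : ℕ} {f : EuclideanSpace ℝ (Fin N) → ℝ} (hf : Continuous f)
    (R : ℝ) : IntegrableOn f (annulus N R) :=
  (hf.continuousOn.integrableOn_compact (isCompact_closedBall 0 (2 * R))).mono_set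
    fun _ hx => mem_closedBall_zero_iff.2 hx.2.le

theorem measurableSet_annulus (N : ℕ) (R : ℝ) : MeasurableSet (annulus N R) :=
  ((isOpen_lt continuous_const continuous_norm).inter
    (isOpen_lt continuous_norm continuous_const)).measurableSet

theorem stmt_0 (N : ℕ) (hN : 1 ≤ N)
    (ω₁ ω₂ : EuclideanSpace ℝ (Fin N) → ℝ)
    (hω₁ : ContDiff ℝ (⊤ : ℕ∞) ω₁) (hω₂ : ContDiff ℝ (⊤ : ℕ∞) ω₂)
    (hω₁pos : ∀ x, 0 < ω₁ x) (hω₂pos : ∀ x, 0 < ω₂ x)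
    (t : ℝ) (ht0 : 0 < t) (ht2 : t < 2)
    (hIG : Tendsto (fun R : ℝ =>
      R ^ (-4*t - 2) * ∫ x in annulus N R, ω₁ x ^ (2*t + 1) / ω₂ x ^ (2*t))
      atTop (nhds 0))
    (hJG : Tendsto (fun R : ℝ =>
      R ^ (-2*t - 1) * ∫ x in annulus N R, ‖gradient ω₁ x‖ ^ (2*t + 1) / ω₂ x ^ (2*t))
      atTop (nhds 0)) :
    ¬ ∃ u : EuclideanSpace ℝ (Fin N) → ℝ, ContDiff ℝ 2 u ∧
      (∀ x, -vdiv (fun y => ω₁ y • gradient u y) x ≤ ω₂ x * Real.exp (u x)) ∧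
      (∀ ψ : EuclideanSpace ℝ (Fin N) → ℝ, ContDiff ℝ 2 ψ → HasCompactSupport ψ →
        ∫ x, ω₂ x * Real.exp (u x) * ψ x ^ 2 ≤ ∫ x, ω₁ x * ‖gradient ψ x‖ ^ 2) := by
  rintro ⟨u, hu, hsub, hstab⟩
  obtain ⟨C, hC, henergy⟩ := exists_stable_energy_bound ht0 ht2
  obtain ⟨K, hK, hyoung⟩ := exists_weighted_young (s := 2 * t) (ε := 1 / (2 * C))
    (by linarith) (by linarith) (by positivity)
  obtain ⟨M, hcut⟩ := exists_cutoff N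
  have hcω₁ := hω₁.continuous
  have hcω₂ := hω₂.continuous
  have hcu := hu.continuous
  set W : EuclideanSpace ℝ (Fin N) → ℝ := fun x => ω₁ x ^ (2 * t + 1) / ω₂ x ^ (2 * t)
  have hW : Continuous W :=
    (hcω₁.rpow_const fun x => Or.inl (hω₁pos x).ne').div
      (hcω₂.rpow_const fun x => Or.inl (hω₂pos x).ne')
      fun x => (Real.rpow_pos_of_pos (hω₂pos x) _).ne'
  obtain ⟨η₁, hη₁, hη₁c, hη₁0, hη₁1, hη₁one, hη₁zero, -, -⟩ := hcut 1 one_pos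
  have hcη₁ := hη₁.continuous
  set p : EuclideanSpace ℝ (Fin N) → ℝ := fun x => ω₂ x * Real.exp ((2 * t + 1) * u x)
  have hp : ∀ x, 0 < p x := fun x => mul_pos (hω₂pos x) (Real.exp_pos _)
  have hcp : Continuous p := by fun_prop
  have hp₁ : Continuous fun x => p x * η₁ x := by fun_prop
  have hpos : 0 < ∫ x, p x * η₁ x := by
    refine hp₁.integral_pos_of_hasCompactSupport_nonneg_nonzero (x := 0) hη₁c.mul_left
      (fun x => mul_nonneg (hp x).le (hη₁0 x)) ?_
    rw [hη₁one 0 (by simp), mul_one]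
    exact (hp 0).ne'
  have hbound : ∀ R : ℝ, 2 ≤ R → ∫ x, p x * η₁ x
      ≤ 2 * C * K * (25 * M ^ 2) ^ (2 * t + 1)
        * (R ^ (-4 * t - 2) * ∫ x in annulus N R, W x) := by
    intro R hR
    have hR0 : 0 < R := by linarith
    obtain ⟨η, hη, hηc, hη0, hη1, hηone, -, hηM, hηann⟩ := hcut R hR0
    have hcη := hη.continuous
    have hφ : ContDiff ℝ 2 fun x => η x ^ 5 := hη.pow 5
    have hφc : HasCompactSupport fun x => η x ^ 5 := hηc.comp_left (g := fun y => y ^ 5) (by simp)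
    have hE := henergy N ω₁ ω₂ u (fun x => η x ^ 5) (hω₁.of_le (by exact_mod_cast le_top)) hcω₂
      hω₁pos hω₂pos hu hsub hstab hφ hφc
    have hb : Integrable fun x => p x * (η x ^ 5) ^ 2 :=
      Continuous.integrable_of_hasCompactSupport (by fun_prop)
        (hφc.comp_left (g := fun y => y ^ 2) (by simp)).mul_left
    have hlow : ∫ x, p x * η₁ x ≤ ∫ x, p x * (η x ^ 5) ^ 2 := by
      refine integral_mono (hp₁.integrable_of_hasCompactSupport hη₁c.mul_left) hb fun x => ?_
      refine mul_le_mul_of_nonneg_left ?_ (hp x).le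
      by_cases hx : ‖x‖ ≤ R
      · rw [hηone x hx]
        simpa using hη₁1 x
      · rw [hη₁zero x (by linarith)]
        positivity
    set r : ℝ := 25 * M ^ 2 * (R ^ 2)⁻¹
    have hgrad : ∀ x, ‖gradient (fun x => η x ^ 5) x‖ ^ 2 = 25 * η x ^ 8 * ‖fderiv ℝ η x‖ ^ 2 := by
      intro x
      have hd : HasFDerivAt (fun x => η x ^ 5) _ x :=
        ((hη.differentiable two_ne_zero x).hasFDerivAt).pow 5
      rw [norm_gradient_eq_norm_fderiv, hd.fderiv, norm_smul, mul_pow, Real.norm_eq_abs, sq_abs,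
        nsmul_eq_mul]
      push_cast
      ring
    have hpt : ∀ x, ω₁ x * Real.exp (2 * t * u x) * ‖gradient (fun x => η x ^ 5) x‖ ^ 2
        ≤ 1 / (2 * C) * (p x * (η x ^ 5) ^ 2)
          + (annulus N R).indicator (fun x => K * r ^ (2 * t + 1) * W x) x := by
      intro x
      by_cases hx : x ∈ annulus N R
      · rw [Set.indicator_of_mem hx]
        have hy := hyoung (ω₁ x) (ω₂ x) (Real.exp (u x)) (η x) r (hω₁pos x) (hω₂pos x)
          (Real.exp_pos _) (hη0 x) (hη1 x) (by positivity)
        rw [← Real.exp_mul, ← Real.exp_mul, mul_comm (u x), mul_comm (u x)] at hy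
        refine le_trans ?_ hy
        have hw : 0 ≤ ω₁ x * Real.exp (2 * t * u x) := mul_nonneg (hω₁pos x).le (Real.exp_pos _).le
        refine mul_le_mul_of_nonneg_left ?_ hw
        rw [hgrad]
        have h1 : ‖fderiv ℝ η x‖ ^ 2 ≤ (M / R) ^ 2 :=
          pow_le_pow_left₀ (norm_nonneg _) (hηM x) 2
        have h2 : 0 ≤ η x ^ 8 := by positivity
        calc 25 * η x ^ 8 * ‖fderiv ℝ η x‖ ^ 2 ≤ 25 * η x ^ 8 * (M / R) ^ 2 := by gcongr
          _ = η x ^ 8 * r := by simp only [r, div_pow]; ring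
      · rw [Set.indicator_of_notMem hx, hgrad, hηann x hx]
        have := hp x
        simp only [norm_zero, ne_eq, OfNat.ofNat_ne_zero, not_false_eq_true, zero_pow, mul_zero]
        positivity
    have hind : Integrable ((annulus N R).indicator fun x => K * r ^ (2 * t + 1) * W x) :=
      (integrableOn_annulus (continuous_const.mul hW) R).integrable_indicator
        (measurableSet_annulus N R)
    have hD : ∫ x, ω₁ x * Real.exp (2 * t * u x) * ‖gradient (fun x => η x ^ 5) x‖ ^ 2
        ≤ 1 / (2 * C) * (∫ x, p x * (η x ^ 5) ^ 2)
          + K * r ^ (2 * t + 1) * ∫ x in annulus N R, W x := by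
      rw [← integral_const_mul, ← integral_const_mul,
        ← integral_indicator (measurableSet_annulus N R), ← integral_add (hb.const_mul _) hind]
      refine integral_mono_of_nonneg (Eventually.of_forall fun x => ?_)
        ((hb.const_mul _).add hind) (Eventually.of_forall hpt)
      have := hω₁pos x
      simp only [Pi.zero_apply]
      positivity
    have hr : r ^ (2 * t + 1) = (25 * M ^ 2) ^ (2 * t + 1) * R ^ (-4 * t - 2) := by
      simp only [r]
      rw [Real.mul_rpow (by positivity) (by positivity), ← Real.rpow_natCast R 2,
        ← Real.rpow_neg hR0.le, ← Real.rpow_mul hR0.le]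
      congr 2
      push_cast
      ring
    refine hlow.trans ?_
    have hCD := mul_le_mul_of_nonneg_left hD hC.le
    rw [hr] at hCD
    have hhalf : C * (1 / (2 * C) * ∫ x, p x * (η x ^ 5) ^ 2)
        = (∫ x, p x * (η x ^ 5) ^ 2) / 2 := by
      field_simp
    linarith
  have hlim := hIG.const_mul (2 * C * K * (25 * M ^ 2) ^ (2 * t + 1))
  rw [mul_zero] at hlim
  exact absurd (ge_of_tendsto hlim (eventually_atTop.2 ⟨2, hbound⟩)) (not_le.2 hpos)
end

section
/- Let N ≥ 1, p > 1, and let ω₁, ω₂ : ℝ^N → ℝ be smooth positive functions. Suppose there exists t with 0 < t < 1/2 such that I_L(R) → 0 and J_L(R) → 0 as R → ∞, where I_L(R) = R^{-2(2t+p−1)/(p−1)} ∫_{R<|x|<2R} (ω₁^{p+2t−1}/ω₂^{2t})^{1/(p−1)} dx and J_L(R) = R^{-(p+2t−1)/(p−1)} ∫_{R<|x|<2R} (|∇ω₁|^{p+2t−1}/ω₂^{2t})^{1/(p−1)} dx. Then there is no positive stable super-solution of the equation −div(ω₁ ∇u) = ω₂ u^p in ℝ^N. -/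
open MeasureTheory Filter Real
open scoped RealInnerProductSpace

/-- Integration by parts for a `C¹` vector field against a compactly supported `C¹` function. -/
theorem integral_neg_vdiv_mul {N : ℕ}
    {V : EuclideanSpace ℝ (Fin N) → EuclideanSpace ℝ (Fin N)} {g : EuclideanSpace ℝ (Fin N) → ℝ}
    (hV : ContDiff ℝ 1 V) (hg : ContDiff ℝ 1 g) (hgc : HasCompactSupport g) :
    Integrable (fun x => -vdiv V x * g x) ∧ Integrable (fun x => fderiv ℝ g x (V x)) ∧
      ∫ x, -vdiv V x * g x = ∫ x, fderiv ℝ g x (V x) := by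
  set e := EuclideanSpace.basisFun (Fin N) ℝ
  have hdg : Continuous (fderiv ℝ g) := hg.continuous_fderiv one_ne_zero
  have hVi : ∀ i, ContDiff ℝ 1 (fun x => ⟪e i, V x⟫) := fun i => contDiff_const.inner ℝ hV
  have hdVi : ∀ i x, fderiv ℝ (fun y => ⟪e i, V y⟫) x (e i) = ⟪e i, fderiv ℝ V x (e i)⟫ := by
    intro i x
    have h := (innerSL ℝ (e i)).hasFDerivAt.comp x (hV.differentiable one_ne_zero x).hasFDerivAt
    have h' : HasFDerivAt (fun y => ⟪e i, V y⟫) ((innerSL ℝ (e i)).comp (fderiv ℝ V x)) x := h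
    rw [h'.fderiv]
    simp
  have htrace : ∀ x, vdiv V x = ∑ i, fderiv ℝ (fun y => ⟪e i, V y⟫) x (e i) := by
    intro x
    rw [vdiv, LinearMap.trace_eq_sum_inner _ e]
    simp [hdVi]
  have hexp : ∀ x, fderiv ℝ g x (V x) = ∑ i, ⟪e i, V x⟫ * fderiv ℝ g x (e i) := by
    intro x
    conv_lhs => rw [← e.sum_repr' (V x)]
    simp [map_sum]
  have hcg : ∀ i, HasCompactSupport (fun x => fderiv ℝ g x (e i)) := fun i =>
    hgc.fderiv_apply (𝕜 := ℝ) (e i)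
  have hint₁ : ∀ i, Integrable (fun x => fderiv ℝ (fun y => ⟪e i, V y⟫) x (e i) * g x) := by
    intro i
    refine Continuous.integrable_of_hasCompactSupport ?_ hgc.mul_left
    exact (((hVi i).continuous_fderiv one_ne_zero).clm_apply continuous_const).mul hg.continuous
  have hint₂ : ∀ i, Integrable (fun x => ⟪e i, V x⟫ * fderiv ℝ g x (e i)) := by
    intro i
    refine Continuous.integrable_of_hasCompactSupport ?_ (hcg i).mul_left
    exact (hVi i).continuous.mul (hdg.clm_apply continuous_const)
  have hint₃ : ∀ i, Integrable (fun x => ⟪e i, V x⟫ * g x) := fun i =>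
    ((hVi i).continuous.mul hg.continuous).integrable_of_hasCompactSupport hgc.mul_left
  have h₁ : (fun x => -vdiv V x * g x) =
      fun x => -∑ i, fderiv ℝ (fun y => ⟪e i, V y⟫) x (e i) * g x := by
    funext x
    rw [htrace, neg_mul, Finset.sum_mul]
  have h₂ : (fun x => fderiv ℝ g x (V x)) = fun x => ∑ i, ⟪e i, V x⟫ * fderiv ℝ g x (e i) :=
    funext hexp
  rw [h₁, h₂]
  refine ⟨(integrable_finsetSum _ fun i _ => hint₁ i).neg,
    integrable_finsetSum _ fun i _ => hint₂ i, ?_⟩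
  rw [integral_neg, integral_finsetSum _ fun i _ => hint₁ i,
    integral_finsetSum _ fun i _ => hint₂ i, ← Finset.sum_neg_distrib]
  refine Finset.sum_congr rfl fun i _ => ?_
  rw [integral_mul_fderiv_eq_neg_fderiv_mul_of_integrable (hint₁ i) (hint₂ i) (hint₃ i)
    (fun x _ => (hVi i).differentiable one_ne_zero x)
    (fun x _ => hg.differentiable one_ne_zero x)]

/-- Cutoffs adapted to the annuli `R < ‖x‖ < 2R`, with gradient of size `O(1/R)`. -/
theorem exists_annulus_cutoff (N : ℕ) : ∃ M : ℝ, 0 ≤ M ∧ ∀ R : ℝ, 0 < R →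
    ∃ η : EuclideanSpace ℝ (Fin N) → ℝ, ContDiff ℝ 1 η ∧ HasCompactSupport η ∧
      (∀ x, 0 ≤ η x) ∧ (∀ x, η x ≤ 1) ∧ (∀ x, ‖x‖ ≤ R → η x = 1) ∧
      (∀ x, ‖fderiv ℝ η x‖ ≤ M / R) ∧ ∀ x ∉ annulus N R, fderiv ℝ η x = 0 := by
  let χ : ContDiffBump (0 : EuclideanSpace ℝ (Fin N)) := ⟨1, 2, one_pos, one_lt_two⟩
  have hχ : ContDiff ℝ 1 χ := χ.contDiff
  obtain ⟨M, hM⟩ := (hχ.continuous_fderiv one_ne_zero).bounded_above_of_compact_support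
    (χ.hasCompactSupport.fderiv (𝕜 := ℝ))
  refine ⟨M, (norm_nonneg _).trans (hM 0), fun R hR => ?_⟩
  have hnorm : ∀ x : EuclideanSpace ℝ (Fin N), ‖R⁻¹ • x‖ = ‖x‖ / R := fun x => by
    rw [norm_smul, norm_inv, Real.norm_of_nonneg hR.le, div_eq_inv_mul]
  have hone : ∀ x : EuclideanSpace ℝ (Fin N), ‖x‖ ≤ R → χ (R⁻¹ • x) = 1 := fun x hx =>
    χ.one_of_mem_closedBall (by
      rw [mem_closedBall_zero_iff, hnorm]
      exact (div_le_one hR).2 hx)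
  have hzero : ∀ x : EuclideanSpace ℝ (Fin N), 2 * R ≤ ‖x‖ → χ (R⁻¹ • x) = 0 := fun x hx =>
    χ.zero_of_le_dist (by
      rw [dist_zero_right, hnorm]
      exact (le_div_iff₀ hR).2 hx)
  refine ⟨fun x => χ (R⁻¹ • x), hχ.comp (contDiff_const_smul R⁻¹), ?_, fun x => χ.nonneg,
    fun x => χ.le_one, hone, fun x => ?_, fun x hx => ?_⟩
  · exact HasCompactSupport.intro (isCompact_closedBall 0 (2 * R)) fun x hx => hzero x
      (by simpa using (not_le.1 (by simpa using hx)).le)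
  · rw [fderiv_comp_smul, norm_smul, norm_inv, Real.norm_of_nonneg hR.le, div_eq_inv_mul]
    exact mul_le_mul_of_nonneg_left (hM _) (inv_nonneg.2 hR.le)
  · rcases le_or_gt ‖x‖ R with h | h
    · refine IsLocalMax.fderiv_eq_zero (Eventually.of_forall fun y => ?_)
      change χ (R⁻¹ • y) ≤ χ (R⁻¹ • x)
      rw [hone x h]
      exact χ.le_one
    · refine IsLocalMin.fderiv_eq_zero (Eventually.of_forall fun y => ?_)
      change χ (R⁻¹ • x) ≤ χ (R⁻¹ • y)
      rw [hzero x (not_lt.1 fun h' => hx ⟨h, h'⟩)]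
      exact χ.nonneg

/-- Young's inequality absorbing the gradient term of the cutoff energy. -/
theorem young_absorb {p t a b v e d K : ℝ} {m : ℕ} (hp : 1 < p) (ht : 0 < t) (ha : 0 < a)
    (hb : 0 < b) (hv : 0 < v) (he₀ : 0 ≤ e) (he₁ : e ≤ 1) (hd : 0 ≤ d) (hK : 0 ≤ K)
    (hm : (p + 2 * t - 1) / (p - 1) ≤ m) :
    K * (a * v ^ (2 * t) * (e ^ (m - 1) * d) ^ 2) ≤
      2 * t / (p + 2 * t - 1) * (b * v ^ (p + 2 * t - 1) * e ^ (2 * m)) +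
      (p - 1) / (p + 2 * t - 1) * (K ^ ((p + 2 * t - 1) / (p - 1)) *
        ((a ^ (p + 2 * t - 1) / b ^ (2 * t)) ^ (1 / (p - 1)) *
          d ^ (2 * (p + 2 * t - 1) / (p - 1)))) := by
  have hp1 : 0 < p - 1 := by linarith
  obtain ⟨r, hr⟩ : ∃ r, r = p + 2 * t - 1 := ⟨_, rfl⟩
  rw [← hr] at hm ⊢
  have hr0 : 0 < r := by linarith
  have hconj : (r / (2 * t)).HolderConjugate (r / (p - 1)) := by
    refine Real.holderConjugate_iff.2 ⟨(one_lt_div (by positivity)).2 (by linarith), ?_⟩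
    rw [inv_div, inv_div, ← add_div, div_eq_one_iff_eq hr0.ne', hr]
    ring
  have hm1 : 1 ≤ m := by
    have : (1 : ℝ) < r / (p - 1) := hconj.symm.lt
    exact_mod_cast (this.le.trans hm)
  set s := 2 * t / r with hs
  have hs0 : 0 < s := by positivity
  have hα : (b ^ s * v ^ (2 * t) * (e ^ (2 * m)) ^ s) ^ (r / (2 * t)) =
      b * v ^ r * e ^ (2 * m) := by
    have h1 : s * (r / (2 * t)) = 1 := by rw [hs]; field_simp
    have h2 : 2 * t * (r / (2 * t)) = r := by field_simp
    rw [mul_rpow (by positivity) (by positivity), mul_rpow (by positivity) (by positivity),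
      ← rpow_mul hb.le, ← rpow_mul hv.le, ← rpow_mul (by positivity), h1, h2, rpow_one, rpow_one]
  have hβ : (K * (a * b ^ (-s) * d ^ 2)) ^ (r / (p - 1)) =
      K ^ (r / (p - 1)) * ((a ^ r / b ^ (2 * t)) ^ (1 / (p - 1)) * d ^ (2 * r / (p - 1))) := by
    rw [mul_rpow hK (by positivity), mul_rpow (by positivity) (by positivity),
      mul_rpow ha.le (by positivity), div_rpow (by positivity) (by positivity),
      ← rpow_mul hb.le, ← rpow_mul hb.le, ← rpow_mul ha.le, ← rpow_natCast d 2,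
      ← rpow_mul hd, div_eq_mul_inv (a ^ _) (b ^ _), ← rpow_neg hb.le]
    have h1 : r * (1 / (p - 1)) = r / (p - 1) := by ring
    have h2 : -(2 * t * (1 / (p - 1))) = -s * (r / (p - 1)) := by rw [hs]; field_simp
    have h3 : ((2 : ℕ) : ℝ) * (r / (p - 1)) = 2 * r / (p - 1) := by push_cast; ring
    rw [h1, h2, h3]
  have hexp : (e ^ (m - 1)) ^ 2 ≤ (e ^ (2 * m)) ^ s := by
    rcases he₀.eq_or_lt with h0 | h0
    · rw [← h0]
      have hm2 : 1 < m := by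
        have : (1 : ℝ) < r / (p - 1) := hconj.symm.lt
        exact_mod_cast (this.trans_le hm)
      rw [zero_pow (by omega)]
      simp only [ne_eq, OfNat.ofNat_ne_zero, not_false_eq_true, zero_pow]
      positivity
    · rw [← pow_mul, ← rpow_natCast e, ← rpow_natCast e, ← rpow_mul he₀]
      refine rpow_le_rpow_of_exponent_ge h0 he₁ ?_
      push_cast [Nat.cast_sub hm1]
      have h1 : r ≤ m * (p - 1) := (div_le_iff₀ hp1).1 hm
      rw [hs, mul_div_assoc', div_le_iff₀ hr0]
      have h2 : 2 * t = r - (p - 1) := by rw [hr]; ring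
      rw [h2]
      nlinarith
  have hyoung := Real.young_inequality_of_nonneg
    (a := b ^ s * v ^ (2 * t) * (e ^ (2 * m)) ^ s) (b := K * (a * b ^ (-s) * d ^ 2))
    (by positivity) (by positivity) hconj
  rw [hα, hβ] at hyoung
  calc K * (a * v ^ (2 * t) * (e ^ (m - 1) * d) ^ 2)
      = K * a * v ^ (2 * t) * d ^ 2 * (e ^ (m - 1)) ^ 2 := by ring
    _ ≤ K * a * v ^ (2 * t) * d ^ 2 * (e ^ (2 * m)) ^ s := by gcongr
    _ = b ^ s * v ^ (2 * t) * (e ^ (2 * m)) ^ s * (K * (a * b ^ (-s) * d ^ 2)) := by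
      rw [rpow_neg hb.le]
      field_simp
    _ ≤ _ := hyoung
    _ = _ := by
      rw [hs]
      field_simp

/-- Pointwise bound for the flux `ω ∇u` tested against `u^(2t-1) φ²`, with `0 < t < 1/2`. -/
theorem fderiv_rpow_mul_sq_flux_le {N : ℕ} {t w : ℝ} (ht2 : t < 1 / 2) (hw : 0 < w)
    {u φ : EuclideanSpace ℝ (Fin N) → ℝ} {x : EuclideanSpace ℝ (Fin N)}
    (hu : DifferentiableAt ℝ u x) (hφ : DifferentiableAt ℝ φ x) (hux : 0 < u x) :
    fderiv ℝ (fun y => u y ^ (2 * t - 1) * φ y ^ 2) x (w • gradient u x) ≤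
      (1 - 2 * t)⁻¹ * (w * u x ^ (2 * t) * ‖fderiv ℝ φ x‖ ^ 2) := by
  have hd := (hu.hasFDerivAt.rpow_const (p := 2 * t - 1) (Or.inl hux.ne')).mul
    (hφ.hasFDerivAt.pow 2)
  have hug : fderiv ℝ u x (gradient u x) = ‖gradient u x‖ ^ 2 := by
    rw [← inner_gradient_left, real_inner_self_eq_norm_sq]
  have hop : |fderiv ℝ φ x (gradient u x)| ≤ ‖fderiv ℝ φ x‖ * ‖gradient u x‖ :=
    (fderiv ℝ φ x).le_opNorm _
  have hs : 0 < 1 - 2 * t := by linarith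
  have hval : fderiv ℝ (fun y => u y ^ (2 * t - 1) * φ y ^ 2) x (w • gradient u x) =
      w * (-(1 - 2 * t) * (u x ^ (t - 1) * φ x * ‖gradient u x‖) ^ 2 +
        2 * (u x ^ (t - 1) * φ x) * (u x ^ t * fderiv ℝ φ x (gradient u x))) := by
    have h1 : u x ^ (2 * t - 1) = u x ^ (t - 1) * u x ^ t := by
      rw [← rpow_add hux]; ring_nf
    have h2 : u x ^ (2 * t - 1 - 1) = (u x ^ (t - 1)) ^ 2 := by
      rw [sq, ← rpow_add hux]; ring_nf
    have := hd.fderiv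
    simp only [Pi.mul_def] at this
    rw [this]
    simp only [map_smul, add_apply, smul_apply,
      smul_eq_mul, nsmul_eq_mul, hug, h1, h2]
    push_cast
    ring
  have h3 : u x ^ (2 * t) = (u x ^ t) ^ 2 := by rw [sq, ← rpow_add hux]; ring_nf
  rw [hval, h3]
  obtain ⟨A, hA⟩ : ∃ A, A = u x ^ (t - 1) * φ x := ⟨_, rfl⟩
  rw [← hA]
  have hB : 0 < u x ^ t := rpow_pos_of_pos hux t
  set B := u x ^ t
  set G := ‖gradient u x‖
  set D := ‖fderiv ℝ φ x‖
  set F := fderiv ℝ φ x (gradient u x)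
  have hAF : A * F ≤ |A| * (D * G) := (le_abs_self _).trans (by
    rw [abs_mul]; exact mul_le_mul_of_nonneg_left hop (abs_nonneg _))
  have hAA : A ^ 2 = |A| ^ 2 := (sq_abs A).symm
  have key : -(1 - 2 * t) * (A * G) ^ 2 + 2 * A * (B * F) ≤ (1 - 2 * t)⁻¹ * (B * D) ^ 2 := by
    have h4 : 2 * A * (B * F) ≤ 2 * B * (|A| * (D * G)) := by
      nlinarith [mul_le_mul_of_nonneg_left hAF hB.le]
    have h5 : (1 - 2 * t)⁻¹ * (B * D) ^ 2 + (1 - 2 * t) * (A * G) ^ 2 -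
        2 * B * (|A| * (D * G)) = (1 - 2 * t)⁻¹ * (B * D - (1 - 2 * t) * (|A| * G)) ^ 2 := by
      rw [mul_pow A, hAA]
      field_simp
      ring
    have h6 : 0 ≤ (1 - 2 * t)⁻¹ * (B * D - (1 - 2 * t) * (|A| * G)) ^ 2 := by positivity
    linarith
  calc _ ≤ w * ((1 - 2 * t)⁻¹ * (B * D) ^ 2) := mul_le_mul_of_nonneg_left key hw.le
    _ = _ := by ring

/-- Caccioppoli-type estimate: the potential energy of a positive super-solution on a ball is
controlled by the weighted integral over the annulus. Stability is not needed. -/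
theorem supersolution_energy_le {N : ℕ} {p t : ℝ} (hp : 1 < p) (ht1 : 0 < t) (ht2 : t < 1 / 2)
    {ω₁ ω₂ u : EuclideanSpace ℝ (Fin N) → ℝ} (hω₁ : ContDiff ℝ 1 ω₁) (hω₂ : Continuous ω₂)
    (hω₁pos : ∀ x, 0 < ω₁ x) (hω₂pos : ∀ x, 0 < ω₂ x) (hu : ContDiff ℝ 2 u)
    (hupos : ∀ x, 0 < u x)
    (hsup : ∀ x, ω₂ x * u x ^ p ≤ -vdiv (fun y => ω₁ y • gradient u y) x) :
    ∃ C : ℝ, ∀ R : ℝ, 0 < R →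
      ∫ x in Metric.ball 0 R, ω₂ x * u x ^ (p + 2 * t - 1) ≤
        C * (R ^ (-2 * (2 * t + p - 1) / (p - 1)) *
          ∫ x in annulus N R, (ω₁ x ^ (p + 2 * t - 1) / ω₂ x ^ (2 * t)) ^ (1 / (p - 1))) := by
  have hp1 : 0 < p - 1 := by linarith
  have hr : 0 < p + 2 * t - 1 := by linarith
  obtain ⟨M, hM0, hM⟩ := exists_annulus_cutoff N
  obtain ⟨m, hm⟩ := exists_nat_ge ((p + 2 * t - 1) / (p - 1))
  set K : ℝ := (1 - 2 * t)⁻¹ * m ^ 2 with hK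
  have hK0 : 0 ≤ K := by
    have : 0 < 1 - 2 * t := by linarith
    positivity
  set q : ℝ := (p + 2 * t - 1) / (p - 1) with hq
  set σ : ℝ := 2 * (p + 2 * t - 1) / (p - 1) with hσ
  have hσ0 : 0 < σ := by positivity
  set W : EuclideanSpace ℝ (Fin N) → ℝ := fun x =>
    (ω₁ x ^ (p + 2 * t - 1) / ω₂ x ^ (2 * t)) ^ (1 / (p - 1)) with hW
  have hWc : Continuous W := by
    refine Continuous.rpow_const (Continuous.div ?_ ?_ ?_) fun _ => Or.inr (by positivity)
    · exact hω₁.continuous.rpow_const fun _ => Or.inr hr.le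
    · exact hω₂.rpow_const fun _ => Or.inr (by positivity)
    · exact fun x => (rpow_pos_of_pos (hω₂pos x) _).ne'
  have hW0 : ∀ x, 0 ≤ W x := fun x => by
    have := hω₁pos x
    have := hω₂pos x
    positivity
  refine ⟨K ^ q * M ^ σ, fun R hR => ?_⟩
  obtain ⟨η, hη, hηc, hη0, hη1, hηone, hηd, hηann⟩ := hM R hR
  have hm0 : m ≠ 0 := by
    rintro rfl
    have : 0 < q := by positivity
    exact absurd hm (by simpa using this)
  set E : EuclideanSpace ℝ (Fin N) → ℝ :=
    fun x => ω₂ x * u x ^ (p + 2 * t - 1) * η x ^ (2 * m) with hE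
  have hpot : Continuous fun x => ω₂ x * u x ^ (p + 2 * t - 1) :=
    hω₂.mul (hu.continuous.rpow_const fun _ => Or.inr hr.le)
  have hpot0 : ∀ x, 0 ≤ ω₂ x * u x ^ (p + 2 * t - 1) := fun x => by
    have := hω₂pos x
    have := hupos x
    positivity
  have hEi : Integrable E := by
    refine (hpot.mul (hη.continuous.pow _)).integrable_of_hasCompactSupport
      (HasCompactSupport.mul_left ?_)
    exact hηc.comp_left (g := fun y : ℝ => y ^ (2 * m)) (by simp [hm0])
  have hgradu : ContDiff ℝ 1 (gradient u) :=
    (InnerProductSpace.toDual ℝ (EuclideanSpace ℝ (Fin N))).symm.contDiff.comp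
      (hu.fderiv_right (m := 1) (by norm_num))
  have hV : ContDiff ℝ 1 fun y => ω₁ y • gradient u y := hω₁.smul hgradu
  have hg : ContDiff ℝ 1 fun y => u y ^ (2 * t - 1) * (η y ^ m) ^ 2 :=
    ((hu.of_le (by norm_num)).rpow_const_of_ne fun x => (hupos x).ne').mul ((hη.pow m).pow 2)
  have hgc : HasCompactSupport fun y => u y ^ (2 * t - 1) * (η y ^ m) ^ 2 :=
    HasCompactSupport.mul_left
      (hηc.comp_left (g := fun y : ℝ => (y ^ m) ^ 2) (by simp [hm0]))
  obtain ⟨hi₁, hi₂, hparts⟩ := integral_neg_vdiv_mul hV hg hgc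
  have hann : MeasurableSet (annulus N R) :=
    (isOpen_lt continuous_const continuous_norm).measurableSet.inter
      (isOpen_lt continuous_norm continuous_const).measurableSet
  have hWi : IntegrableOn W (annulus N R) :=
    (hWc.continuousOn.integrableOn_compact (isCompact_closedBall 0 (2 * R))).mono_set
      fun x hx => by simpa using hx.2.le
  have hlower : ∀ x, E x ≤ -vdiv (fun y => ω₁ y • gradient u y) x *
      (u x ^ (2 * t - 1) * (η x ^ m) ^ 2) := by
    intro x
    have hpow : u x ^ (p + 2 * t - 1) = u x ^ p * u x ^ (2 * t - 1) := by
      rw [← rpow_add (hupos x)]; ring_nf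
    calc E x = ω₂ x * u x ^ p * (u x ^ (2 * t - 1) * (η x ^ m) ^ 2) := by
          simp only [hE]; rw [hpow]; ring
      _ ≤ _ := mul_le_mul_of_nonneg_right (hsup x) (by have := hupos x; positivity)
  have hupper : ∀ x, fderiv ℝ (fun y => u y ^ (2 * t - 1) * (η y ^ m) ^ 2) x
      (ω₁ x • gradient u x) ≤ 2 * t / (p + 2 * t - 1) * E x +
        (p - 1) / (p + 2 * t - 1) * (K ^ q * (M / R) ^ σ) * (annulus N R).indicator W x := by
    intro x
    have hηx := hη.differentiable one_ne_zero x
    have hφ : ‖fderiv ℝ (fun y => η y ^ m) x‖ = m * (η x ^ (m - 1) * ‖fderiv ℝ η x‖) := by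
      have h := (hηx.hasFDerivAt.pow m).fderiv
      rw [h, norm_smul, Real.norm_of_nonneg (by have := hη0 x; simp; positivity)]
      simp [mul_assoc]
    have h1 := fderiv_rpow_mul_sq_flux_le (φ := fun y => η y ^ m) ht2 (hω₁pos x)
      (hu.differentiable two_ne_zero x) (hηx.pow m) (hupos x)
    rw [hφ] at h1
    have h2 := young_absorb hp ht1 (hω₁pos x) (hω₂pos x) (hupos x) (hη0 x) (hη1 x)
      (norm_nonneg (fderiv ℝ η x)) hK0 hm
    have h3 : ‖fderiv ℝ η x‖ ^ σ * W x ≤ (M / R) ^ σ * (annulus N R).indicator W x := by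
      by_cases hx : x ∈ annulus N R
      · rw [Set.indicator_of_mem hx]
        exact mul_le_mul_of_nonneg_right
          (rpow_le_rpow (norm_nonneg _) (hηd x) hσ0.le) (hW0 x)
      · rw [Set.indicator_of_notMem hx, hηann x hx, norm_zero, zero_rpow hσ0.ne']
        simp
    calc _ ≤ _ := h1
      _ = K * (ω₁ x * u x ^ (2 * t) * (η x ^ (m - 1) * ‖fderiv ℝ η x‖) ^ 2) := by
        rw [hK]; ring
      _ ≤ _ := h2
      _ = 2 * t / (p + 2 * t - 1) * E x +
          (p - 1) / (p + 2 * t - 1) * K ^ q * (‖fderiv ℝ η x‖ ^ σ * W x) := by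
        simp only [hE, hW]; ring
      _ ≤ 2 * t / (p + 2 * t - 1) * E x + (p - 1) / (p + 2 * t - 1) * K ^ q *
          ((M / R) ^ σ * (annulus N R).indicator W x) := by gcongr
      _ = _ := by ring
  have hind : Integrable ((annulus N R).indicator W) := hWi.integrable_indicator hann
  have hmain : ∫ x, E x ≤ 2 * t / (p + 2 * t - 1) * (∫ x, E x) +
      (p - 1) / (p + 2 * t - 1) * (K ^ q * (M / R) ^ σ) * ∫ x in annulus N R, W x := by
    calc ∫ x, E x ≤ _ := integral_mono hEi hi₁ hlower
      _ = _ := hparts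
      _ ≤ _ := integral_mono hi₂ ((hEi.const_mul _).add (hind.const_mul _)) hupper
      _ = _ := by
        rw [integral_add' (hEi.const_mul _) (hind.const_mul _), integral_const_mul,
          integral_const_mul, integral_indicator hann]
  have hEle : ∫ x, E x ≤ K ^ q * (M / R) ^ σ * ∫ x in annulus N R, W x := by
    have h := mul_le_mul_of_nonneg_left hmain hr.le
    have h' : (p + 2 * t - 1) * (2 * t / (p + 2 * t - 1) * (∫ x, E x) +
        (p - 1) / (p + 2 * t - 1) * (K ^ q * (M / R) ^ σ) * ∫ x in annulus N R, W x) =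
        2 * t * (∫ x, E x) + (p - 1) * (K ^ q * (M / R) ^ σ * ∫ x in annulus N R, W x) := by
      field_simp
    rw [h'] at h
    exact le_of_mul_le_mul_left (by linarith) hp1
  calc ∫ x in Metric.ball 0 R, ω₂ x * u x ^ (p + 2 * t - 1)
      = ∫ x in Metric.ball 0 R, E x := by
        refine setIntegral_congr_fun measurableSet_ball fun x hx => ?_
        simp [hE, hηone x (mem_ball_zero_iff.1 hx).le]
    _ ≤ ∫ x, E x := setIntegral_le_integral hEi
        (Eventually.of_forall fun x => mul_nonneg (hpot0 x) (pow_nonneg (hη0 x) _))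
    _ ≤ _ := hEle
    _ = _ := by
      have hexp : -2 * (2 * t + p - 1) / (p - 1) = -σ := by rw [hσ]; ring
      rw [div_rpow hM0 hR.le, hexp, rpow_neg hR.le]
      ring

theorem stmt_2 (N : ℕ) (hN : 1 ≤ N) (p : ℝ) (hp : 1 < p)
    (ω₁ ω₂ : EuclideanSpace ℝ (Fin N) → ℝ)
    (hω₁ : ContDiff ℝ (⊤ : ℕ∞) ω₁) (hω₂ : ContDiff ℝ (⊤ : ℕ∞) ω₂)
    (hω₁pos : ∀ x, 0 < ω₁ x) (hω₂pos : ∀ x, 0 < ω₂ x)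
    (t : ℝ) (ht1 : 0 < t) (ht2 : t < 1/2)
    (hIL : Tendsto (fun R : ℝ =>
      R ^ (-2*(2*t + p - 1)/(p - 1)) *
        ∫ x in annulus N R, (ω₁ x ^ (p + 2*t - 1) / ω₂ x ^ (2*t)) ^ (1/(p - 1)))
      atTop (nhds 0))
    (hJL : Tendsto (fun R : ℝ =>
      R ^ (-(p + 2*t - 1)/(p - 1)) *
        ∫ x in annulus N R, (‖gradient ω₁ x‖ ^ (p + 2*t - 1) / ω₂ x ^ (2*t)) ^ (1/(p - 1)))
      atTop (nhds 0)) :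
    ¬ ∃ u : EuclideanSpace ℝ (Fin N) → ℝ, ContDiff ℝ 2 u ∧ (∀ x, 0 < u x) ∧
      (∀ x, ω₂ x * u x ^ p ≤ -vdiv (fun y => ω₁ y • gradient u y) x) ∧
      (∀ ψ : EuclideanSpace ℝ (Fin N) → ℝ, ContDiff ℝ 2 ψ → HasCompactSupport ψ →
        ∫ x, p * ω₂ x * u x ^ (p - 1) * ψ x ^ 2 ≤ ∫ x, ω₁ x * ‖gradient ψ x‖ ^ 2) := by
  rintro ⟨u, hu, hupos, hsup, -⟩
  obtain ⟨C, hC⟩ := supersolution_energy_le hp ht1 ht2 (hω₁.of_le (by exact_mod_cast le_top))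
    hω₂.continuous hω₁pos hω₂pos hu hupos hsup
  have hpot : Continuous fun x => ω₂ x * u x ^ (p + 2 * t - 1) :=
    hω₂.continuous.mul (hu.continuous.rpow_const fun x => Or.inl (hupos x).ne')
  have hpotpos : ∀ x, 0 < ω₂ x * u x ^ (p + 2 * t - 1) := fun x =>
    mul_pos (hω₂pos x) (rpow_pos_of_pos (hupos x) _)
  have hint : ∀ R, IntegrableOn (fun x => ω₂ x * u x ^ (p + 2 * t - 1)) (Metric.ball 0 R) :=
    fun R => (hpot.continuousOn.integrableOn_compact (isCompact_closedBall 0 R)).mono_set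
      Metric.ball_subset_closedBall
  have hpos : 0 < ∫ x in Metric.ball 0 1, ω₂ x * u x ^ (p + 2 * t - 1) := by
    rw [setIntegral_pos_iff_support_of_nonneg_ae
      (Eventually.of_forall fun x => (hpotpos x).le) (hint 1),
      Set.inter_eq_right.2 fun x _ => Function.mem_support.2 (hpotpos x).ne']
    exact Metric.measure_ball_pos _ _ one_pos
  have hlim := hIL.const_mul C
  rw [mul_zero] at hlim
  refine hpos.not_ge (ge_of_tendsto hlim ?_)
  filter_upwards [eventually_ge_atTop 1] with R hR
  exact (setIntegral_mono_set (hint R) (Eventually.of_forall fun x => (hpotpos x).le)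
    (Metric.ball_subset_ball hR).eventuallyLE).trans (hC R (one_pos.trans_le hR))
end

section
/- Let N ≥ 1, p > 1, and let ω₁, ω₂ : ℝ^N → ℝ be smooth positive functions with ∇ω₁(x) · x ≤ 0 for all x with |x| sufficiently large. Suppose there exists t with 1 ≤ t < p + √(p(p−1)) such that I_L(R) → 0 as R → ∞, where I_L(R) = R^{-2(2t+p−1)/(p−1)} ∫_{R<|x|<2R} (ω₁^{p+2t−1}/ω₂^{2t})^{1/(p−1)} dx. Then there is no positive stable sub-solution of the equation −div(ω₁ ∇u) = ω₂ u^p in ℝ^N. -/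
open MeasureTheory Filter Real
open scoped RealInnerProductSpace

theorem stable_exponent_gap {p t : ℝ} (hp : 1 < p) (ht1 : 1 ≤ t)
    (ht2 : t < p + Real.sqrt (p * (p - 1))) : t ^ 2 < p * (2 * t - 1) := by
  have h0 : 0 ≤ p * (p - 1) := by nlinarith
  have hs := Real.sq_sqrt h0
  have hsn := Real.sqrt_nonneg (p * (p - 1))
  have hlow : p - 1 < Real.sqrt (p * (p - 1)) := Real.lt_sqrt_of_sq_lt (by nlinarith)
  nlinarith [mul_pos (sub_pos.2 ht2) (by linarith : 0 < t - (p - Real.sqrt (p * (p - 1))))]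

theorem exists_energy_const {p t : ℝ} (hp : 1 < p) (ht1 : 1 ≤ t)
    (ht2 : t < p + Real.sqrt (p * (p - 1))) :
    ∃ K : ℝ, 0 ≤ K ∧ ∀ A B C D : ℝ, p * A ≤ t ^ 2 * B + 2 * t * C + D →
      (2 * t - 1) * B + 2 * C ≤ A → (∀ ε : ℝ, 0 < ε → |2 * C| ≤ ε * B + D / ε) →
      A ≤ K * D := by
  have hgap := stable_exponent_gap hp ht1 ht2
  obtain ⟨δ, hδ⟩ : ∃ δ, δ = p * (2 * t - 1) - t ^ 2 := ⟨_, rfl⟩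
  have hδ0 : 0 < δ := by linarith
  have hpt : 0 < t + p := by linarith
  obtain ⟨ε, hε⟩ : ∃ ε, ε = δ / (2 * (t + p)) := ⟨_, rfl⟩
  have hε0 : 0 < ε := by rw [hε]; positivity
  have hεδ : ε * (t + p) = δ / 2 := by rw [hε]; field_simp
  obtain ⟨s, hs⟩ : ∃ s, s = 2 * t - 1 - ε := ⟨_, rfl⟩
  have hs0 : 0 < s := by
    by_contra h
    have : (2 * t - 1) * (t + p) ≤ ε * (t + p) :=
      mul_le_mul_of_nonneg_right (by linarith) hpt.le
    nlinarith [mul_pos hpt hε0, sq_nonneg t]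
  refine ⟨((t ^ 2 + t * ε) / ε + s * (t / ε + 1)) / (δ / 2), by positivity, ?_⟩
  intro A B C D h1 h2 h3
  obtain ⟨h3l, h3r⟩ := abs_le.1 (h3 ε hε0)
  have hB : s * B ≤ A + D / ε := by rw [hs]; linarith
  have hA : p * A ≤ (t ^ 2 + t * ε) * B + (t / ε + 1) * D := by
    have : t * (2 * C) ≤ t * (ε * B + D / ε) := mul_le_mul_of_nonneg_left h3r (by linarith)
    have e : t * (D / ε) = t / ε * D := by ring
    nlinarith
  have hA' := mul_le_mul_of_nonneg_left hA hs0.le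
  have hB' := mul_le_mul_of_nonneg_left hB (by positivity : 0 ≤ t ^ 2 + t * ε)
  have e1 : (t ^ 2 + t * ε) * (A + D / ε)
      = (t ^ 2 + t * ε) * A + (t ^ 2 + t * ε) / ε * D := by ring
  have e2 : s * (p * A) - (t ^ 2 + t * ε) * A = δ / 2 * A := by
    have : s * p - (t ^ 2 + t * ε) = δ / 2 := by rw [hs]; linarith
    rw [← this]; ring
  rw [div_mul_eq_mul_div, le_div_iff₀ (by positivity)]
  nlinarith

theorem exists_young_const {a b : ℝ} (hab : a.HolderConjugate b) {δ : ℝ} (hδ : 0 < δ) :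
    ∃ C : ℝ, 0 ≤ C ∧ ∀ X Y : ℝ, 0 ≤ X → 0 ≤ Y → X * Y ≤ δ * X ^ a + C * Y ^ b := by
  have ha := hab.pos
  have hb := hab.symm.pos
  obtain ⟨l, hl⟩ : ∃ l, l = δ ^ (1 / a) := ⟨_, rfl⟩
  have hl0 : 0 < l := by rw [hl]; positivity
  have hla : l ^ a = δ := by rw [hl, ← rpow_mul hδ.le, one_div_mul_cancel ha.ne', rpow_one]
  refine ⟨(1 / l) ^ b, by positivity, fun X Y hX hY => ?_⟩
  have h := Real.young_inequality_of_nonneg (mul_nonneg hl0.le hX)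
    (mul_nonneg (one_div_nonneg.2 hl0.le) hY) hab
  rw [mul_rpow hl0.le hX, mul_rpow (one_div_nonneg.2 hl0.le) hY, hla] at h
  have e : l * X * (1 / l * Y) = X * Y := by field_simp
  rw [e] at h
  refine h.trans (add_le_add (div_le_self (by positivity) hab.lt.le)
    (div_le_self (by positivity) hab.symm.lt.le))

theorem exists_weighted_young_const {p t : ℝ} (hp : 1 < p) (ht : 0 < t) (m : ℕ) (hm : 1 ≤ m)
    (hmq : p + 2 * t - 1 ≤ m * (p - 1)) {δ : ℝ} (hδ : 0 < δ) :
    ∃ C : ℝ, 0 ≤ C ∧ ∀ a b u χ s : ℝ, 0 < a → 0 < b → 0 < u → 0 ≤ χ → χ ≤ 1 → 0 ≤ s →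
      a * u ^ (2 * t) * (m * χ ^ (m - 1) * s) ^ 2 ≤
        δ * (b * u ^ (p + 2 * t - 1) * (χ ^ m) ^ 2) +
          C * ((a ^ (p + 2 * t - 1) / b ^ (2 * t)) ^ (1 / (p - 1)) *
            s ^ (2 * (p + 2 * t - 1) / (p - 1))) := by
  obtain ⟨q, hq⟩ : ∃ q, q = p + 2 * t - 1 := ⟨_, rfl⟩
  rw [← hq] at hmq ⊢
  have hq0 : 0 < q := by linarith
  have hp1 : 0 < p - 1 := by linarith
  have hab : (q / (2 * t)).HolderConjugate (q / (p - 1)) := by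
    rw [Real.holderConjugate_iff]
    refine ⟨by rw [lt_div_iff₀ (by positivity)]; linarith, ?_⟩
    field_simp
    linarith
  obtain ⟨C, hC, hY⟩ := exists_young_const hab hδ
  have hm0 : (0 : ℝ) < m := by exact_mod_cast hm
  refine ⟨C * ((m : ℝ) ^ 2) ^ (q / (p - 1)), by positivity, ?_⟩
  intro a b u χ s ha hb hu hχ hχ1 hs
  have h := hY ((b * u ^ q) ^ (2 * t / q) * χ ^ (2 * (m - 1)))
    (a * b ^ (-(2 * t / q)) * (m ^ 2 * s ^ 2)) (by positivity) (by positivity)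
  have e1 : (b * u ^ q) ^ (2 * t / q) * χ ^ (2 * (m - 1)) *
      (a * b ^ (-(2 * t / q)) * (m ^ 2 * s ^ 2)) =
      a * u ^ (2 * t) * (m * χ ^ (m - 1) * s) ^ 2 := by
    rw [mul_rpow hb.le (by positivity), ← rpow_mul hu.le, mul_div_cancel₀ _ hq0.ne',
      rpow_neg hb.le]
    field_simp
    ring
  have e2 : ((b * u ^ q) ^ (2 * t / q) * χ ^ (2 * (m - 1))) ^ (q / (2 * t)) ≤
      b * u ^ q * (χ ^ m) ^ 2 := by
    rw [mul_rpow (by positivity) (by positivity), ← rpow_mul (by positivity),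
      show 2 * t / q * (q / (2 * t)) = 1 by field_simp, rpow_one]
    refine mul_le_mul_of_nonneg_left ?_ (by positivity)
    rw [← pow_mul, ← rpow_natCast χ (2 * (m - 1)), ← rpow_natCast χ (m * 2), ← rpow_mul hχ]
    have hex : ((m * 2 : ℕ) : ℝ) ≤ ((2 * (m - 1) : ℕ) : ℝ) * (q / (2 * t)) := by
      push_cast [Nat.cast_sub hm]
      rw [← mul_div_assoc, le_div_iff₀ (by positivity)]
      nlinarith
    rcases hχ.eq_or_lt with h0 | h0
    · rw [← h0, zero_rpow, zero_rpow]
      · positivity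
      · have : (0 : ℝ) < ((m * 2 : ℕ) : ℝ) := by push_cast; positivity
        linarith
    · exact rpow_le_rpow_of_exponent_ge h0 hχ1 hex
  have e3 : (a * b ^ (-(2 * t / q)) * (m ^ 2 * s ^ 2)) ^ (q / (p - 1)) =
      ((m : ℝ) ^ 2) ^ (q / (p - 1)) *
        ((a ^ q / b ^ (2 * t)) ^ (1 / (p - 1)) * s ^ (2 * q / (p - 1))) := by
    have i1 : (s ^ 2) ^ (q / (p - 1)) = s ^ (2 * q / (p - 1)) := by
      rw [← rpow_natCast s 2, ← rpow_mul hs]; congr 1; push_cast; ring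
    have i2 : (a * b ^ (-(2 * t / q))) ^ (q / (p - 1)) =
        (a ^ q / b ^ (2 * t)) ^ (1 / (p - 1)) := by
      rw [div_eq_mul_inv (a ^ q), ← rpow_neg hb.le, mul_rpow ha.le (by positivity),
        mul_rpow (by positivity) (by positivity), ← rpow_mul hb.le, ← rpow_mul hb.le,
        ← rpow_mul ha.le, mul_one_div]
      congr 2
      field_simp
    have hY0 : 0 ≤ a * b ^ (-(2 * t / q)) := by positivity
    rw [mul_rpow hY0 (by positivity), mul_rpow (sq_nonneg _) (sq_nonneg s), i1, i2]
    ring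
  rw [e1, e3] at h
  calc _ ≤ _ := h
    _ ≤ _ := by
      rw [mul_assoc C]
      gcongr

theorem deriv_smoothTransition_eq_zero_of_nonpos {x : ℝ} (hx : x ≤ 0) :
    deriv smoothTransition x = 0 :=
  IsLocalMin.deriv_eq_zero <| Eventually.of_forall fun y => by
    rw [smoothTransition.zero_of_nonpos hx]; exact smoothTransition.nonneg y

theorem deriv_smoothTransition_eq_zero_of_one_le {x : ℝ} (hx : 1 ≤ x) :
    deriv smoothTransition x = 0 :=
  IsLocalMax.deriv_eq_zero <| Eventually.of_forall fun y => by
    rw [smoothTransition.one_of_one_le hx]; exact smoothTransition.le_one y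

section Gradient

variable {F : Type*} [NormedAddCommGroup F] [InnerProductSpace ℝ F] [CompleteSpace F]

theorem HasGradientAt.mul_real {f g : F → ℝ} {f' g' x : F} (hf : HasGradientAt f f' x)
    (hg : HasGradientAt g g' x) : HasGradientAt (fun y => f y * g y) (f x • g' + g x • f') x := by
  rw [hasGradientAt_iff_hasFDerivAt] at *
  exact (hf.mul hg).congr_fderiv (by simp [map_add])

theorem HasDerivAt.comp_hasGradientAt {h : ℝ → ℝ} {h' : ℝ} {f : F → ℝ} {f' x : F}
    (hh : HasDerivAt h h' (f x)) (hf : HasGradientAt f f' x) :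
    HasGradientAt (fun y => h (f y)) (h' • f') x := by
  rw [hasGradientAt_iff_hasFDerivAt] at *
  exact (hh.comp_hasFDerivAt x hf).congr_fderiv (by simp [map_smul])

theorem ContDiff.continuous_gradient_real {f : F → ℝ} {n : WithTop ℕ∞} (hf : ContDiff ℝ n f)
    (hn : n ≠ 0) : Continuous (gradient f) :=
  (InnerProductSpace.toDual ℝ F).symm.continuous.comp (hf.continuous_fderiv hn)

theorem ContDiff.gradient_real {f : F → ℝ} {m n : WithTop ℕ∞} (hf : ContDiff ℝ n f)
    (hmn : m + 1 ≤ n) : ContDiff ℝ m (gradient f) :=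
  (InnerProductSpace.toDual ℝ F).symm.contDiff.comp (hf.fderiv_right hmn)

end Gradient

theorem exists_cutoff_annulus (N : ℕ) : ∃ M : ℝ, 0 ≤ M ∧ ∀ R : ℝ, 0 < R →
    ∃ χ : EuclideanSpace ℝ (Fin N) → ℝ, ContDiff ℝ 2 χ ∧ HasCompactSupport χ ∧
      (∀ x, 0 ≤ χ x) ∧ (∀ x, χ x ≤ 1) ∧ (∀ x, ‖x‖ ≤ R → χ x = 1) ∧
      (∀ x, ‖gradient χ x‖ ≤ M / R) ∧ (∀ x, x ∉ annulus N R → gradient χ x = 0) := by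
  have hsm : ContDiff ℝ 2 smoothTransition := smoothTransition.contDiff (n := 2)
  obtain ⟨M, hM⟩ := (isCompact_Icc (a := (-2 : ℝ)) (b := 2)).exists_bound_of_continuousOn
    (hsm.continuous_deriv (by norm_num)).continuousOn
  have hM0 : 0 ≤ M := (norm_nonneg _).trans (hM 0 (by norm_num))
  refine ⟨4 * M, by positivity, fun R hR => ?_⟩
  have hgrad : ∀ x : EuclideanSpace ℝ (Fin N),
      HasGradientAt (fun y => smoothTransition (2 - ‖y‖ ^ 2 / R ^ 2))
        (deriv smoothTransition (2 - ‖x‖ ^ 2 / R ^ 2) • (-(2 / R ^ 2) • x)) x := by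
    intro x
    refine HasDerivAt.comp_hasGradientAt
      ((hsm.differentiable (by norm_num)).differentiableAt.hasDerivAt) ?_
    rw [hasGradientAt_iff_hasFDerivAt]
    have h := ((hasStrictFDerivAt_norm_sq x).hasFDerivAt.mul_const (1 / R ^ 2)).const_sub 2
    simp only [mul_one_div] at h
    refine h.congr_fderiv ?_
    ext y
    simp
    ring
  have hzero : ∀ x, x ∉ annulus N R →
      gradient (fun y : EuclideanSpace ℝ (Fin N) => smoothTransition (2 - ‖y‖ ^ 2 / R ^ 2)) x
        = 0 := by
    intro x hx
    rw [(hgrad x).gradient]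
    have : deriv smoothTransition (2 - ‖x‖ ^ 2 / R ^ 2) = 0 := by
      by_cases h : R < ‖x‖
      · have h2 : 2 * R ≤ ‖x‖ := by
          by_contra h3
          exact hx ⟨h, not_le.1 h3⟩
        apply deriv_smoothTransition_eq_zero_of_nonpos
        rw [sub_nonpos, le_div_iff₀ (by positivity)]
        nlinarith
      · apply deriv_smoothTransition_eq_zero_of_one_le
        rw [le_sub_comm, div_le_iff₀ (by positivity)]
        nlinarith [norm_nonneg x]
    rw [this, zero_smul]
  refine ⟨fun y => smoothTransition (2 - ‖y‖ ^ 2 / R ^ 2), ?_, ?_,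
    fun x => smoothTransition.nonneg _,
    fun x => smoothTransition.le_one _, ?_, ?_, hzero⟩
  · exact hsm.comp (contDiff_const.sub ((contDiff_norm_sq ℝ).div_const _))
  · refine HasCompactSupport.intro (isCompact_closedBall (0 : EuclideanSpace ℝ (Fin N)) (2 * R)) ?_
    intro x hx
    have h2 : 2 * R < ‖x‖ := by simpa using hx
    apply smoothTransition.zero_of_nonpos
    rw [sub_nonpos, le_div_iff₀ (by positivity)]
    nlinarith
  · intro x hx
    apply smoothTransition.one_of_one_le
    rw [le_sub_comm, div_le_iff₀ (by positivity)]
    nlinarith [norm_nonneg x]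
  · intro x
    by_cases hx : x ∈ annulus N R
    · rw [(hgrad x).gradient, norm_smul, norm_smul]
      have h1 : ‖deriv smoothTransition (2 - ‖x‖ ^ 2 / R ^ 2)‖ ≤ M := by
        apply hM
        constructor
        · rw [le_sub_comm, div_le_iff₀ (by positivity)]
          nlinarith [norm_nonneg x, hx.1, hx.2]
        · have : 0 ≤ ‖x‖ ^ 2 / R ^ 2 := by positivity
          linarith
      have h2 : ‖-(2 / R ^ 2)‖ * ‖x‖ ≤ 4 / R := by
        rw [norm_neg, Real.norm_of_nonneg (by positivity)]
        calc 2 / R ^ 2 * ‖x‖ ≤ 2 / R ^ 2 * (2 * R) := by gcongr; exact hx.2.le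
          _ = 4 / R := by field_simp; norm_num
      calc _ ≤ M * (4 / R) := by gcongr
        _ = 4 * M / R := by ring
    · rw [hzero x hx, norm_zero]; positivity

theorem integral_vdiv_mul_eq_neg {N : ℕ}
    {V : EuclideanSpace ℝ (Fin N) → EuclideanSpace ℝ (Fin N)}
    {g : EuclideanSpace ℝ (Fin N) → ℝ} (hV : ContDiff ℝ 1 V) (hg : ContDiff ℝ 1 g)
    (hgc : HasCompactSupport g) :
    ∫ x, ⟪V x, gradient g x⟫ = -∫ x, vdiv V x * g x := by
  let b := EuclideanSpace.basisFun (Fin N) ℝ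
  have hf : ∀ i, ContDiff ℝ 1 (fun x => ⟪b i, V x⟫) := fun i => contDiff_const.inner ℝ hV
  have hfd : ∀ i x v, fderiv ℝ (fun x => ⟪b i, V x⟫) x v = ⟪b i, fderiv ℝ V x v⟫ := by
    intro i x v
    have := fderiv_inner_apply ℝ (differentiableAt_const (b i))
      (hV.differentiable (by norm_num) x) v
    simpa using this
  have hgcd : ∀ i, HasCompactSupport (fun x => fderiv ℝ g x (b i)) := fun i =>
    hgc.fderiv_apply ℝ (b i)
  have hgd : ∀ i, Continuous (fun x => fderiv ℝ g x (b i)) := fun i =>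
    (hg.continuous_fderiv (by norm_num)).clm_apply continuous_const
  have hfdc : ∀ i, Continuous (fun x => fderiv ℝ (fun x => ⟪b i, V x⟫) x (b i)) := fun i =>
    ((hf i).continuous_fderiv (by norm_num)).clm_apply continuous_const
  have i1 : ∀ i, Integrable (fun x => ⟪b i, V x⟫ * fderiv ℝ g x (b i)) := fun i =>
    ((hf i).continuous.mul (hgd i)).integrable_of_hasCompactSupport (hgcd i).mul_left
  have i2 : ∀ i, Integrable (fun x => fderiv ℝ (fun x => ⟪b i, V x⟫) x (b i) * g x) := fun i =>
    ((hfdc i).mul hg.continuous).integrable_of_hasCompactSupport hgc.mul_left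
  have e1 : ∀ x, ⟪V x, gradient g x⟫ = ∑ i, ⟪b i, V x⟫ * fderiv ℝ g x (b i) := by
    intro x
    rw [← b.sum_inner_mul_inner (V x) (gradient g x)]
    refine Finset.sum_congr rfl fun i _ => ?_
    rw [inner_gradient_right, real_inner_comm]
    simp
  have e2 : ∀ x, vdiv V x * g x = ∑ i, fderiv ℝ (fun x => ⟪b i, V x⟫) x (b i) * g x := by
    intro x
    rw [vdiv, LinearMap.trace_eq_sum_inner _ b, Finset.sum_mul]
    refine Finset.sum_congr rfl fun i _ => ?_
    rw [hfd]
    rfl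
  simp_rw [e1, e2]
  rw [integral_finsetSum _ fun i _ => i1 i, integral_finsetSum _ fun i _ => i2 i,
    ← Finset.sum_neg_distrib]
  refine Finset.sum_congr rfl fun i _ => ?_
  exact integral_mul_fderiv_eq_neg_fderiv_mul_of_integrable (i2 i) (i1 i)
    (((hf i).continuous.mul hg.continuous).integrable_of_hasCompactSupport hgc.mul_left)
    (fun x _ => (hf i).differentiable (by norm_num) x)
    (fun x _ => hg.differentiable (by norm_num) x)

theorem continuous_vdiv {N : ℕ} {V : EuclideanSpace ℝ (Fin N) → EuclideanSpace ℝ (Fin N)}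
    (hV : ContDiff ℝ 1 V) : Continuous (vdiv V) :=
  (LinearMap.continuous_of_finiteDimensional
    ((LinearMap.trace ℝ (EuclideanSpace ℝ (Fin N))).comp (ContinuousLinearMap.coeLM ℝ))).comp
    (hV.continuous_fderiv (by norm_num))

theorem integrable_of_continuous_of_eq_zero {N : ℕ} {f φ : EuclideanSpace ℝ (Fin N) → ℝ}
    (hφ : HasCompactSupport φ) (hf : Continuous f) (h : ∀ x, x ∉ tsupport φ → f x = 0) :
    Integrable f :=
  hf.integrable_of_hasCompactSupport (HasCompactSupport.intro hφ fun x hx => h x hx)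

theorem gradient_eq_zero_of_notMem_tsupport {N : ℕ} {φ : EuclideanSpace ℝ (Fin N) → ℝ}
    {x : EuclideanSpace ℝ (Fin N)} (hx : x ∉ tsupport φ) : gradient φ x = 0 := by
  have : fderiv ℝ φ x = 0 := by
    by_contra h
    exact hx (support_fderiv_subset ℝ h)
  rw [gradient, this, map_zero]

theorem exists_caccioppoli_const {p t : ℝ} (hp : 1 < p) (ht1 : 1 ≤ t)
    (ht2 : t < p + Real.sqrt (p * (p - 1))) :
    ∃ K : ℝ, 0 ≤ K ∧ ∀ (N : ℕ) (ω₁ ω₂ u φ : EuclideanSpace ℝ (Fin N) → ℝ),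
      ContDiff ℝ 1 ω₁ → Continuous ω₂ → (∀ x, 0 < ω₁ x) →
      ContDiff ℝ 2 u → (∀ x, 0 < u x) →
      (∀ x, -vdiv (fun y => ω₁ y • gradient u y) x ≤ ω₂ x * u x ^ p) →
      (∀ ψ : EuclideanSpace ℝ (Fin N) → ℝ, ContDiff ℝ 2 ψ → HasCompactSupport ψ →
        ∫ x, p * ω₂ x * u x ^ (p - 1) * ψ x ^ 2 ≤ ∫ x, ω₁ x * ‖gradient ψ x‖ ^ 2) →
      ContDiff ℝ 2 φ → HasCompactSupport φ →
      ∫ x, ω₂ x * u x ^ (p + 2 * t - 1) * φ x ^ 2 ≤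
        K * ∫ x, ω₁ x * u x ^ (2 * t) * ‖gradient φ x‖ ^ 2 := by
  obtain ⟨K, hK, hKey⟩ := exists_energy_const hp ht1 ht2
  refine ⟨K, hK, ?_⟩
  intro N ω₁ ω₂ u φ hω₁ hω₂ hω₁pos hu hupos hsub hstab hφ hφc
  have cω₁ := hω₁.continuous
  have cu := hu.continuous
  have cφ := hφ.continuous
  have cgu := hu.continuous_gradient_real (by norm_num)
  have cgφ := hφ.continuous_gradient_real (by norm_num)
  have cpow : ∀ r : ℝ, Continuous fun x => u x ^ r := fun r =>
    cu.rpow_const fun x => Or.inl (hupos x).ne'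
  have zφ : ∀ x, x ∉ tsupport φ → φ x = 0 := fun x hx => image_eq_zero_of_notMem_tsupport hx
  have zgφ : ∀ x, x ∉ tsupport φ → gradient φ x = 0 := fun x hx =>
    gradient_eq_zero_of_notMem_tsupport hx
  have iA : Integrable fun x => ω₂ x * u x ^ (p + 2 * t - 1) * φ x ^ 2 :=
    integrable_of_continuous_of_eq_zero hφc ((hω₂.mul (cpow _)).mul (cφ.pow 2))
      fun x hx => by simp [zφ x hx]
  have iB : Integrable fun x => ω₁ x * u x ^ (2 * t - 2) * φ x ^ 2 * ‖gradient u x‖ ^ 2 :=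
    integrable_of_continuous_of_eq_zero hφc
      (((cω₁.mul (cpow _)).mul (cφ.pow 2)).mul (cgu.norm.pow 2)) fun x hx => by simp [zφ x hx]
  have iC : Integrable fun x => ω₁ x * u x ^ (2 * t - 1) * φ x * ⟪gradient u x, gradient φ x⟫ :=
    integrable_of_continuous_of_eq_zero hφc
      (((cω₁.mul (cpow _)).mul cφ).mul (cgu.inner cgφ)) fun x hx => by simp [zφ x hx]
  have iD : Integrable fun x => ω₁ x * u x ^ (2 * t) * ‖gradient φ x‖ ^ 2 :=
    integrable_of_continuous_of_eq_zero hφc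
      ((cω₁.mul (cpow _)).mul (cgφ.norm.pow 2)) fun x hx => by simp [zgφ x hx]
  have upow : ∀ (r : ℝ) x, HasGradientAt (fun y => u y ^ r)
      ((r * u x ^ (r - 1)) • gradient u x) x := fun r x =>
    (Real.hasDerivAt_rpow_const (Or.inl (hupos x).ne')).comp_hasGradientAt
      (hu.differentiable (by norm_num) x).hasGradientAt
  have cdpow : ∀ r : ℝ, ContDiff ℝ 2 fun x => u x ^ r := fun r =>
    hu.rpow_const_of_ne fun x => (hupos x).ne'
  have gφ : ∀ x, HasGradientAt φ (gradient φ x) x := fun x =>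
    (hφ.differentiable (by norm_num) x).hasGradientAt
  apply hKey _ (∫ x, ω₁ x * u x ^ (2 * t - 2) * φ x ^ 2 * ‖gradient u x‖ ^ 2)
    (∫ x, ω₁ x * u x ^ (2 * t - 1) * φ x * ⟪gradient u x, gradient φ x⟫)
  · have h := hstab (fun x => u x ^ t * φ x) ((cdpow t).mul hφ) hφc.mul_left
    have e1 : ∀ x, p * ω₂ x * u x ^ (p - 1) * (u x ^ t * φ x) ^ 2 =
        p * (ω₂ x * u x ^ (p + 2 * t - 1) * φ x ^ 2) := by
      intro x
      rw [show p + 2 * t - 1 = (p - 1) + t + t by ring, rpow_add (hupos x), rpow_add (hupos x)]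
      ring
    have e2 : ∀ x, ω₁ x * ‖gradient (fun x => u x ^ t * φ x) x‖ ^ 2 =
        t ^ 2 * (ω₁ x * u x ^ (2 * t - 2) * φ x ^ 2 * ‖gradient u x‖ ^ 2) +
        2 * t * (ω₁ x * u x ^ (2 * t - 1) * φ x * ⟪gradient u x, gradient φ x⟫) +
        ω₁ x * u x ^ (2 * t) * ‖gradient φ x‖ ^ 2 := by
      intro x
      rw [((upow t x).mul_real (gφ x)).gradient, norm_add_sq_real, smul_smul, norm_smul, norm_smul,
        real_inner_smul_left, real_inner_smul_right, mul_pow, mul_pow, Real.norm_eq_abs,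
        Real.norm_eq_abs, sq_abs, sq_abs, real_inner_comm,
        show 2 * t - 2 = (t - 1) + (t - 1) by ring, show 2 * t - 1 = t + (t - 1) by ring,
        show 2 * t = t + t by ring, rpow_add (hupos x), rpow_add (hupos x), rpow_add (hupos x)]
      ring
    have iBC : Integrable fun x =>
        t ^ 2 * (ω₁ x * u x ^ (2 * t - 2) * φ x ^ 2 * ‖gradient u x‖ ^ 2) +
        2 * t * (ω₁ x * u x ^ (2 * t - 1) * φ x * ⟪gradient u x, gradient φ x⟫) :=
      (iB.const_mul _).add (iC.const_mul _)
    simp_rw [e1, e2] at h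
    rw [integral_const_mul, integral_add iBC iD,
      integral_add (iB.const_mul _) (iC.const_mul _), integral_const_mul, integral_const_mul] at h
    exact h
  · have hV : ContDiff ℝ 1 fun y => ω₁ y • gradient u y :=
      hω₁.smul (hu.gradient_real (by norm_num))
    have hg : ContDiff ℝ 2 fun x => u x ^ (2 * t - 1) * (φ x * φ x) :=
      (cdpow _).mul (hφ.mul hφ)
    have hgc : HasCompactSupport fun x => u x ^ (2 * t - 1) * (φ x * φ x) :=
      hφc.mul_left.mul_left
    have hint := integral_vdiv_mul_eq_neg hV (hg.of_le (by norm_num)) hgc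
    have e1 : ∀ x, ⟪ω₁ x • gradient u x, gradient (fun x => u x ^ (2 * t - 1) * (φ x * φ x)) x⟫ =
        (2 * t - 1) * (ω₁ x * u x ^ (2 * t - 2) * φ x ^ 2 * ‖gradient u x‖ ^ 2) +
        2 * (ω₁ x * u x ^ (2 * t - 1) * φ x * ⟪gradient u x, gradient φ x⟫) := by
      intro x
      rw [((upow (2 * t - 1) x).mul_real ((gφ x).mul_real (gφ x))).gradient]
      simp only [inner_add_right, real_inner_smul_left, real_inner_smul_right,
        real_inner_self_eq_norm_sq, show 2 * t - 1 - 1 = 2 * t - 2 by ring]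
      ring
    simp_rw [e1] at hint
    rw [integral_add (iB.const_mul _) (iC.const_mul _), integral_const_mul, integral_const_mul,
      ← integral_neg] at hint
    rw [hint]
    refine integral_mono (((continuous_vdiv hV).mul hg.continuous).integrable_of_hasCompactSupport
      hgc.mul_left).neg iA fun x => ?_
    have hu0 := hupos x
    calc -(vdiv (fun y => ω₁ y • gradient u y) x * (u x ^ (2 * t - 1) * (φ x * φ x)))
        = -vdiv (fun y => ω₁ y • gradient u y) x * (u x ^ (2 * t - 1) * (φ x * φ x)) := by ring
      _ ≤ ω₂ x * u x ^ p * (u x ^ (2 * t - 1) * (φ x * φ x)) :=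
        mul_le_mul_of_nonneg_right (hsub x)
          (mul_nonneg (by positivity) (mul_self_nonneg _))
      _ = ω₂ x * u x ^ (p + 2 * t - 1) * φ x ^ 2 := by
        rw [show p + 2 * t - 1 = p + (2 * t - 1) by ring, rpow_add hu0]
        ring
  · intro ε hε
    rw [← integral_const_mul, ← integral_const_mul, ← integral_div,
      ← integral_add (iB.const_mul _) (iD.div_const _)]
    refine abs_integral_le_integral_abs.trans
      (integral_mono (iC.const_mul _).abs ((iB.const_mul _).add (iD.div_const _)) fun x => ?_)
    have hu0 := hupos x
    have h1 : u x ^ (2 * t - 2) = (u x ^ (t - 1)) ^ 2 := by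
      rw [show 2 * t - 2 = (t - 1) + (t - 1) by ring, rpow_add hu0]; ring
    have h2 : u x ^ (2 * t - 1) = u x ^ t * u x ^ (t - 1) := by
      rw [show 2 * t - 1 = t + (t - 1) by ring, rpow_add hu0]
    have h3 : u x ^ (2 * t) = (u x ^ t) ^ 2 := by
      rw [show 2 * t = t + t by ring, rpow_add hu0]; ring
    have hin := abs_real_inner_le_norm (gradient u x) (gradient φ x)
    simp only [h1, h2, h3]
    have hω := hω₁pos x
    have hut : 0 < u x ^ t := by positivity
    have hut1 : 0 < u x ^ (t - 1) := by positivity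
    rw [abs_mul, abs_mul, abs_mul, abs_mul, abs_two, abs_of_pos hω, abs_of_pos (mul_pos hut hut1)]
    obtain ⟨X, hX⟩ : ∃ X, X = u x ^ (t - 1) * |φ x| * ‖gradient u x‖ := ⟨_, rfl⟩
    obtain ⟨Y, hY⟩ : ∃ Y, Y = u x ^ t * ‖gradient φ x‖ := ⟨_, rfl⟩
    have hXY : 2 * (X * Y) ≤ ε * X ^ 2 + Y ^ 2 / ε := by
      have : ε * X ^ 2 + Y ^ 2 / ε - 2 * (X * Y) = (ε * X - Y) ^ 2 / ε := by
        field_simp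
        ring
      have : 0 ≤ (ε * X - Y) ^ 2 / ε := by positivity
      linarith
    calc 2 * (ω₁ x * (u x ^ t * u x ^ (t - 1)) * |φ x| * |⟪gradient u x, gradient φ x⟫|)
        ≤ 2 * (ω₁ x * (u x ^ t * u x ^ (t - 1)) * |φ x| *
            (‖gradient u x‖ * ‖gradient φ x‖)) := by gcongr
      _ = ω₁ x * (2 * (X * Y)) := by rw [hX, hY]; ring
      _ ≤ ω₁ x * (ε * X ^ 2 + Y ^ 2 / ε) := by gcongr
      _ = _ := by
        rw [hX, hY, mul_pow, mul_pow, sq_abs]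
        ring

theorem stmt_5 (N : ℕ) (hN : 1 ≤ N) (p : ℝ) (hp : 1 < p)
    (ω₁ ω₂ : EuclideanSpace ℝ (Fin N) → ℝ)
    (hω₁ : ContDiff ℝ (⊤ : ℕ∞) ω₁) (hω₂ : ContDiff ℝ (⊤ : ℕ∞) ω₂)
    (hω₁pos : ∀ x, 0 < ω₁ x) (hω₂pos : ∀ x, 0 < ω₂ x)
    (hmono : ∃ R₀ : ℝ, ∀ x : EuclideanSpace ℝ (Fin N), R₀ ≤ ‖x‖ → ⟪gradient ω₁ x, x⟫ ≤ 0)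
    (t : ℝ) (ht1 : 1 ≤ t) (ht2 : t < p + Real.sqrt (p * (p - 1)))
    (hIL : Tendsto (fun R : ℝ =>
      R ^ (-2*(2*t + p - 1)/(p - 1)) *
        ∫ x in annulus N R, (ω₁ x ^ (p + 2*t - 1) / ω₂ x ^ (2*t)) ^ (1/(p - 1)))
      atTop (nhds 0)) :
    ¬ ∃ u : EuclideanSpace ℝ (Fin N) → ℝ, ContDiff ℝ 2 u ∧ (∀ x, 0 < u x) ∧
      (∀ x, -vdiv (fun y => ω₁ y • gradient u y) x ≤ ω₂ x * u x ^ p) ∧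
      (∀ ψ : EuclideanSpace ℝ (Fin N) → ℝ, ContDiff ℝ 2 ψ → HasCompactSupport ψ →
        ∫ x, p * ω₂ x * u x ^ (p - 1) * ψ x ^ 2 ≤ ∫ x, ω₁ x * ‖gradient ψ x‖ ^ 2) := by
  rintro ⟨u, hu, hupos, hsub, hstab⟩
  obtain ⟨K, hK, hcac⟩ := exists_caccioppoli_const hp ht1 ht2
  obtain ⟨M, hM, hcut⟩ := exists_cutoff_annulus N
  have hp1 : 0 < p - 1 := by linarith
  obtain ⟨q, hq⟩ : ∃ q, q = p + 2 * t - 1 := ⟨_, rfl⟩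
  have hq0 : 0 < q := by linarith
  obtain ⟨m₀, hm₀⟩ := exists_nat_ge (q / (p - 1))
  obtain ⟨m, hm⟩ : ∃ m, m = m₀ + 1 := ⟨_, rfl⟩
  have hm1 : 1 ≤ m := by omega
  have hmq : p + 2 * t - 1 ≤ m * (p - 1) := by
    rw [← hq, ← div_le_iff₀ hp1, hm]; push_cast; linarith
  have hδ : 0 < 1 / (2 * (K + 1)) := by positivity
  obtain ⟨C, hC, hyoung⟩ := exists_weighted_young_const hp (by linarith : 0 < t) m hm1 hmq hδ
  rw [← hq] at hyoung
  obtain ⟨W, hW⟩ : ∃ W : EuclideanSpace ℝ (Fin N) → ℝ,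
    W = fun x => (ω₁ x ^ q / ω₂ x ^ (2 * t)) ^ (1 / (p - 1)) := ⟨_, rfl⟩
  have cu := hu.continuous
  have cω₁ := hω₁.continuous
  have cω₂ := hω₂.continuous
  have hWpos : ∀ x, 0 < W x := fun x => by
    have h1 := hω₁pos x
    have h2 := hω₂pos x
    rw [hW]; positivity
  have cW : Continuous W := by
    rw [hW]
    refine Continuous.rpow_const ?_ fun x => Or.inr (by positivity)
    exact (cω₁.rpow_const fun x => Or.inl (hω₁pos x).ne').div
      (cω₂.rpow_const fun x => Or.inl (hω₂pos x).ne')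
      fun x => (rpow_pos_of_pos (hω₂pos x) _).ne'
  have cpow : ∀ r : ℝ, Continuous fun x => u x ^ r := fun r =>
    cu.rpow_const fun x => Or.inl (hupos x).ne'
  have cf : Continuous fun x => ω₂ x * u x ^ q := cω₂.mul (cpow q)
  have fpos : ∀ x, 0 < ω₂ x * u x ^ q := fun x =>
    mul_pos (hω₂pos x) (rpow_pos_of_pos (hupos x) _)
  have hmeas : ∀ R, MeasurableSet (annulus N R) := fun R =>
    ((isOpen_lt continuous_const continuous_norm).inter
      (isOpen_lt continuous_norm continuous_const)).measurableSet
  have hc0 : 0 < ∫ x in Metric.ball (0 : EuclideanSpace ℝ (Fin N)) 1, ω₂ x * u x ^ q := by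
    rw [setIntegral_pos_iff_support_of_nonneg_ae]
    · have : Function.support (fun x => ω₂ x * u x ^ q) = Set.univ :=
        Set.eq_univ_of_forall fun x => (fpos x).ne'
      rw [this, Set.univ_inter]
      exact Metric.measure_ball_pos _ _ one_pos
    · exact Eventually.of_forall fun x => (fpos x).le
    · exact (cf.continuousOn.integrableOn_compact (isCompact_closedBall _ 1)).mono_set
        Metric.ball_subset_closedBall
  have main : ∀ R : ℝ, 1 ≤ R → ∫ x in Metric.ball (0 : EuclideanSpace ℝ (Fin N)) 1,
      ω₂ x * u x ^ q ≤ 2 * K * C * M ^ (2 * q / (p - 1)) *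
        (R ^ (-2 * (2 * t + p - 1) / (p - 1)) * ∫ x in annulus N R, W x) := by
    intro R hR
    have hR0 : 0 < R := by linarith
    obtain ⟨χ, hχ, hχc, hχ0, hχ1, hχR, hgχ, hgχ0⟩ := hcut R hR0
    have hmχc : HasCompactSupport fun x => χ x ^ m :=
      HasCompactSupport.intro hχc fun x hx => by
        rw [image_eq_zero_of_notMem_tsupport hx, zero_pow (by omega)]
    have h1 := hcac N ω₁ ω₂ u (fun x => χ x ^ m) (hω₁.of_le (by exact_mod_cast le_top)) cω₂ hω₁pos
      hu hupos hsub hstab (hχ.pow m) hmχc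
    rw [← hq] at h1
    have hgm : ∀ x, ‖gradient (fun x => χ x ^ m) x‖ = m * χ x ^ (m - 1) * ‖gradient χ x‖ := by
      intro x
      rw [((hasDerivAt_pow m (χ x)).comp_hasGradientAt
        (hχ.differentiable (by norm_num) x).hasGradientAt).gradient, norm_smul,
        Real.norm_of_nonneg (mul_nonneg (Nat.cast_nonneg m) (pow_nonneg (hχ0 x) _))]
    simp_rw [hgm] at h1
    have cgχ := hχ.continuous_gradient_real (by norm_num)
    have zχ : ∀ x, x ∉ tsupport χ → χ x = 0 := fun x hx => image_eq_zero_of_notMem_tsupport hx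
    have zgχ : ∀ x, x ∉ tsupport χ → gradient χ x = 0 := fun x hx =>
      gradient_eq_zero_of_notMem_tsupport hx
    have hexp : 0 < 2 * q / (p - 1) := by positivity
    have iA : Integrable fun x => ω₂ x * u x ^ q * (χ x ^ m) ^ 2 :=
      integrable_of_continuous_of_eq_zero hχc (cf.mul ((hχ.continuous.pow m).pow 2))
        fun x hx => by simp [zχ x hx, show m ≠ 0 by omega]
    have iD : Integrable fun x =>
        ω₁ x * u x ^ (2 * t) * (m * χ x ^ (m - 1) * ‖gradient χ x‖) ^ 2 :=
      integrable_of_continuous_of_eq_zero hχc ((cω₁.mul (cpow _)).mul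
        (((continuous_const.mul (hχ.continuous.pow _)).mul cgχ.norm).pow 2))
        fun x hx => by simp [zgχ x hx]
    have iE : Integrable fun x => W x * ‖gradient χ x‖ ^ (2 * q / (p - 1)) :=
      integrable_of_continuous_of_eq_zero hχc
        (cW.mul (cgχ.norm.rpow_const fun x => Or.inr hexp.le))
        fun x hx => by simp [zgχ x hx, zero_rpow hexp.ne']
    have hD : ∫ x, ω₁ x * u x ^ (2 * t) * (m * χ x ^ (m - 1) * ‖gradient χ x‖) ^ 2 ≤
        1 / (2 * (K + 1)) * (∫ x, ω₂ x * u x ^ q * (χ x ^ m) ^ 2) +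
          C * ∫ x, W x * ‖gradient χ x‖ ^ (2 * q / (p - 1)) := by
      rw [← integral_const_mul, ← integral_const_mul,
        ← integral_add (iA.const_mul _) (iE.const_mul _)]
      refine integral_mono iD ((iA.const_mul _).add (iE.const_mul _)) fun x => ?_
      have := hyoung (ω₁ x) (ω₂ x) (u x) (χ x) ‖gradient χ x‖ (hω₁pos x) (hω₂pos x) (hupos x)
        (hχ0 x) (hχ1 x) (norm_nonneg _)
      simpa [hW] using this
    have hE : ∫ x, W x * ‖gradient χ x‖ ^ (2 * q / (p - 1)) ≤
        (M / R) ^ (2 * q / (p - 1)) * ∫ x in annulus N R, W x := by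
      have e : ∫ x, W x * ‖gradient χ x‖ ^ (2 * q / (p - 1)) =
          ∫ x in annulus N R, W x * ‖gradient χ x‖ ^ (2 * q / (p - 1)) :=
        (setIntegral_eq_integral_of_forall_compl_eq_zero fun x hx => by
          simp [hgχ0 x hx, zero_rpow hexp.ne']).symm
      rw [e, ← integral_const_mul]
      refine setIntegral_mono_on iE.integrableOn ?_ (hmeas R) fun x _ => ?_
      · refine IntegrableOn.mono_set (t := Metric.closedBall 0 (2 * R))
          ((continuous_const.mul cW).continuousOn.integrableOn_compact
            (isCompact_closedBall _ _)) fun x hx => ?_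
        simpa using hx.2.le
      · rw [mul_comm]
        exact mul_le_mul_of_nonneg_right
          (rpow_le_rpow (norm_nonneg _) (hgχ x) hexp.le) (hWpos x).le
    have hA0 : 0 ≤ ∫ x, ω₂ x * u x ^ q * (χ x ^ m) ^ 2 :=
      integral_nonneg fun x => mul_nonneg (fpos x).le (sq_nonneg _)
    have hcA : ∫ x in Metric.ball (0 : EuclideanSpace ℝ (Fin N)) 1, ω₂ x * u x ^ q ≤
        ∫ x, ω₂ x * u x ^ q * (χ x ^ m) ^ 2 := by
      have e : ∫ x in Metric.ball (0 : EuclideanSpace ℝ (Fin N)) 1, ω₂ x * u x ^ q =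
          ∫ x in Metric.ball (0 : EuclideanSpace ℝ (Fin N)) 1,
            ω₂ x * u x ^ q * (χ x ^ m) ^ 2 :=
        setIntegral_congr_fun measurableSet_ball fun x hx => by
          have : ‖x‖ ≤ R := by
            have : ‖x‖ < 1 := by simpa using hx
            linarith
          simp [hχR x this]
      rw [e]
      exact setIntegral_le_integral iA
        (Eventually.of_forall fun x => mul_nonneg (fpos x).le (sq_nonneg _))
    have hKA : K * (1 / (2 * (K + 1)) * ∫ x, ω₂ x * u x ^ q * (χ x ^ m) ^ 2) ≤
        1 / 2 * ∫ x, ω₂ x * u x ^ q * (χ x ^ m) ^ 2 := by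
      rw [← mul_assoc]
      refine mul_le_mul_of_nonneg_right ?_ hA0
      rw [mul_one_div, div_le_div_iff₀ (by positivity) (by positivity)]
      linarith
    have hKD := mul_le_mul_of_nonneg_left hD hK
    have hKE := mul_le_mul_of_nonneg_left hE (mul_nonneg hK hC)
    have e3 : (M / R) ^ (2 * q / (p - 1)) =
        M ^ (2 * q / (p - 1)) * R ^ (-2 * (2 * t + p - 1) / (p - 1)) := by
      rw [div_rpow hM hR0.le, div_eq_mul_inv, ← rpow_neg hR0.le, hq]
      congr 2
      ring
    rw [e3] at hKE
    nlinarith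
  have hlim : Tendsto (fun R : ℝ => 2 * K * C * M ^ (2 * q / (p - 1)) *
      (R ^ (-2 * (2 * t + p - 1) / (p - 1)) * ∫ x in annulus N R, W x)) atTop (nhds 0) := by
    have := hIL.const_mul (2 * K * C * M ^ (2 * q / (p - 1)))
    rw [mul_zero] at this
    rw [hW, hq]
    rw [hq] at this
    exact this
  exact absurd (ge_of_tendsto hlim ((eventually_ge_atTop 1).mono main)) (not_le.2 hc0)
end
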